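/- arXiv:0903.5056 — 2 statements merged into one kernel-verified Lean document; each statement's English description precedes it below -/
import Mathlib

section
/- Let n ≥ 0 be an integer and let p, q ∈ ℝ[x,y] be real polynomials in two variables of total degree at most n. Define Ĩ : (0, 1/64) → ℝ by Ĩ(t) = ∬_{Δ(t)} (∂(x·q)/∂x − ∂(x·p)/∂y) dx dy (which by Green's theorem equals the Abelian integral ∮_{δ(t)} x·(p dx + q dy)). Then the set of isolated zeros of Ĩ in (0, 1/64) is finite, and its cardinality N satisfies 4N ≤ 7n + 43 (i.e. N ≤ (7n + 43)/4). (These zeros control the limit cycles born from δ(t) in the perturbation (1/x)dH − εω = 0 of the integrable quadratic vector field with ω = p dx + q dy.) -/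
open MeasureTheory Set Filter

/-- The region bounded by the real oval of `{x^2 y (1-x-y) = t}` in the first quadrant. -/
def Δset (t : ℝ) : Set (ℝ × ℝ) :=
  {z : ℝ × ℝ | 0 < z.1 ∧ 0 < z.2 ∧ t ≤ z.1 ^ 2 * z.2 * (1 - z.1 - z.2)}

/-- The Abelian integral `I_{i,j}(t) = ∬_{Δ(t)} x^i y^j dx dy` (integer powers). -/
noncomputable def Iab (i j : ℤ) (t : ℝ) : ℝ :=
  ∫ z in Δset t, z.1 ^ i * z.2 ^ j

noncomputable def J1 (t : ℝ) : ℝ := Iab 0 0 t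
noncomputable def J2 (t : ℝ) : ℝ := Iab 2 0 t
noncomputable def J3 (t : ℝ) : ℝ := Iab 3 0 t

/-- The Abelian integral of the 1-form `x·(p dx + q dy)` over `δ(t)`, written via Green's
theorem as a double integral of `∂(x·q)/∂x - ∂(x·p)/∂y` over `Δ(t)`. -/
noncomputable def abelIntX (p q : MvPolynomial (Fin 2) ℝ) (t : ℝ) : ℝ :=
  ∫ z in Δset t,
    MvPolynomial.eval ![z.1, z.2]
      (MvPolynomial.pderiv (0 : Fin 2) (MvPolynomial.X 0 * q) -
        MvPolynomial.pderiv (1 : Fin 2) (MvPolynomial.X 0 * p))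

lemma finite_and_ncard_le_of_separated {S T : Set ℝ} (hT : T.Finite)
    (h : ∀ a ∈ S, ∀ b ∈ S, a < b → ∃ c ∈ T, a < c ∧ c < b) :
    S.Finite ∧ S.ncard ≤ T.ncard + 1 := by
  have key : ∀ F : Finset ℝ, (F : Set ℝ) ⊆ S → F.card ≤ T.ncard + 1 := by
    intro F hF
    rw [Set.ncard_eq_toFinset_card T hT]
    refine Finset.card_le_of_interleaved fun x hx y hy hxy _ => ?_
    obtain ⟨c, hc, h1, h2⟩ := h x (hF hx) y (hF hy) hxy
    exact ⟨c, hT.mem_toFinset.2 hc, h1, h2⟩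
  have hS : S.Finite := by
    by_contra hinf
    obtain ⟨F, hF, hcard⟩ := (show S.Infinite from hinf).exists_subset_card_eq (T.ncard + 2)
    have := key F hF
    omega
  refine ⟨hS, ?_⟩
  rw [Set.ncard_eq_toFinset_card S hS]
  exact key _ (by simp)

/-- Either `f` vanishes identically on `(0, 1/64)`, or it has at most `N` zeros there. -/
def ZerosLE (f : ℝ → ℝ) (N : ℕ) : Prop :=
  (∀ t ∈ Ioo (0 : ℝ) (1 / 64), f t = 0) ∨
    ({t | t ∈ Ioo (0 : ℝ) (1 / 64) ∧ f t = 0}.Finite ∧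
      {t | t ∈ Ioo (0 : ℝ) (1 / 64) ∧ f t = 0}.ncard ≤ N)

lemma ZerosLE.congr {f g : ℝ → ℝ} {N : ℕ} (hf : ZerosLE f N)
    (h : ∀ t ∈ Ioo (0 : ℝ) (1 / 64), f t = 0 ↔ g t = 0) : ZerosLE g N := by
  have : {t | t ∈ Ioo (0 : ℝ) (1 / 64) ∧ f t = 0} = {t | t ∈ Ioo (0 : ℝ) (1 / 64) ∧ g t = 0} := by
    ext t
    exact and_congr_right (h t)
  rcases hf with hf | hf
  · exact Or.inl fun t ht => (h t ht).1 (hf t ht)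
  · exact Or.inr (this ▸ hf)

lemma ZerosLE.mono {f : ℝ → ℝ} {N M : ℕ} (hf : ZerosLE f N) (h : N ≤ M) : ZerosLE f M :=
  hf.imp_right fun hf => ⟨hf.1, hf.2.trans h⟩

lemma zerosLE_of_no_zeros {f : ℝ → ℝ} (N : ℕ) (h : ∀ t ∈ Ioo (0 : ℝ) (1 / 64), f t ≠ 0) :
    ZerosLE f N := by
  have : {t | t ∈ Ioo (0 : ℝ) (1 / 64) ∧ f t = 0} = ∅ := by
    ext t
    simpa using fun h1 h2 => h t ⟨h1, by simpa using h2⟩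
  exact Or.inr (by simp only [this, finite_empty, ncard_empty, zero_le, and_self])

/-- Rolle's theorem as a bound on the number of zeros. -/
lemma ZerosLE.of_deriv {f f' : ℝ → ℝ} {N : ℕ} (hf' : ZerosLE f' N)
    (hd : ∀ t ∈ Ioo (0 : ℝ) (1 / 64), HasDerivAt f (f' t) t) : ZerosLE f (N + 1) := by
  rcases hf' with h0 | ⟨hfin, hcard⟩
  · have hconst : ∀ x ∈ Ioo (0 : ℝ) (1 / 64), ∀ y ∈ Ioo (0 : ℝ) (1 / 64), f x = f y := by
      intro x hx y hy
      refine isOpen_Ioo.is_const_of_deriv_eq_zero isPreconnected_Ioo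
        (fun t ht => (hd t ht).differentiableAt.differentiableWithinAt) ?_ hx hy
      intro t ht
      simp [(hd t ht).deriv, h0 t ht]
    by_cases h : ∃ t ∈ Ioo (0 : ℝ) (1 / 64), f t = 0
    · obtain ⟨t, ht, hft⟩ := h
      exact Or.inl fun x hx => (hconst x hx t ht).trans hft
    · push Not at h
      exact zerosLE_of_no_zeros _ h
  · have := finite_and_ncard_le_of_separated (S := {t | t ∈ Ioo (0 : ℝ) (1 / 64) ∧ f t = 0}) hfin ?_
    · exact Or.inr ⟨this.1, this.2.trans (by omega)⟩
    · rintro a ⟨ha, hfa⟩ b ⟨hb, hfb⟩ hab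
      have hsub : ∀ x ∈ Icc a b, x ∈ Ioo (0 : ℝ) (1 / 64) :=
        fun x hx => ⟨ha.1.trans_le hx.1, hx.2.trans_lt hb.2⟩
      obtain ⟨c, hc, hc0⟩ := exists_hasDerivAt_eq_zero hab
        (fun x hx => (hd x (hsub x hx)).continuousAt.continuousWithinAt) (hfa.trans hfb.symm)
        (fun x hx => hd x (hsub x (Ioo_subset_Icc_self hx)))
      exact ⟨c, ⟨hsub c (Ioo_subset_Icc_self hc), hc0⟩, hc.1, hc.2⟩

/-- An integrating factor for the linear equation `F' = h F + r` on a segment. -/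
lemma exists_integrating_factor {a b : ℝ} (hab : a ≤ b) {h : ℝ → ℝ}
    (hh : ContinuousOn h (Icc a b)) :
    ∃ E : ℝ → ℝ, (∀ x, 0 < E x) ∧ ∀ x ∈ Icc a b, HasDerivAt E (-h x * E x) x := by
  set g : ℝ → ℝ := IccExtend hab ((Icc a b).domRestrict h) with hg
  have hgc : Continuous g := (continuousOn_iff_continuous_domRestrict.1 hh).Icc_extend'
  refine ⟨fun x => Real.exp (-∫ u in a..x, g u), fun x => Real.exp_pos _, fun x hx => ?_⟩
  have hgx : g x = h x := by rw [hg, IccExtend_of_mem _ _ hx]; rfl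
  have := ((hgc.integral_hasStrictDerivAt a x).hasDerivAt.neg).exp
  rw [hgx] at this
  exact this.congr_deriv (by simp only [Pi.neg_apply]; ring)

lemma exists_zero_of_linear_ode {a b : ℝ} (hab : a < b) {F h r : ℝ → ℝ}
    (hh : ContinuousOn h (Icc a b))
    (hF : ∀ x ∈ Icc a b, HasDerivAt F (h x * F x + r x) x) (ha : F a = 0) (hb : F b = 0) :
    ∃ c ∈ Ioo a b, r c = 0 := by
  obtain ⟨E, hE, hE'⟩ := exists_integrating_factor hab.le hh
  have hd : ∀ x ∈ Icc a b, HasDerivAt (fun x => F x * E x) (r x * E x) x := fun x hx =>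
    ((hF x hx).mul (hE' x hx)).congr_deriv (by ring)
  obtain ⟨c, hc, hc0⟩ := exists_hasDerivAt_eq_zero hab
    (fun x hx => (hd x hx).continuousAt.continuousWithinAt) (by simp [ha, hb])
    (fun x hx => hd x (Ioo_subset_Icc_self hx))
  exact ⟨c, hc, (mul_eq_zero.1 hc0).resolve_right (hE c).ne'⟩

lemma eq_zero_iff_of_linear_ode {a b : ℝ} (hab : a ≤ b) {F h : ℝ → ℝ}
    (hh : ContinuousOn h (Icc a b))
    (hF : ∀ x ∈ Icc a b, HasDerivAt F (h x * F x) x) : F a = 0 ↔ F b = 0 := by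
  obtain ⟨E, hE, hE'⟩ := exists_integrating_factor hab hh
  have hd : ∀ x ∈ Icc a b, HasDerivAt (fun x => F x * E x) 0 x := fun x hx =>
    ((hF x hx).mul (hE' x hx)).congr_deriv (by ring)
  have := constant_of_has_deriv_right_zero
    (fun x hx => (hd x hx).continuousAt.continuousWithinAt)
    (fun x hx => (hd x (Ico_subset_Icc_self hx)).hasDerivWithinAt) b (right_mem_Icc.2 hab)
  have h1 := (hE a).ne'
  have h2 := (hE b).ne'
  constructor
  · intro h
    simpa [h, h2] using this
  · intro h
    simpa [h, h1] using this.symm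

open Polynomial in
lemma ZerosLE.polynomial_mul {F : ℝ → ℝ} {N : ℕ} (hF : ZerosLE F N) {G : ℝ[X]} (hG : G ≠ 0) :
    ZerosLE (fun t => G.eval t * F t) (N + G.natDegree) := by
  rcases hF with h0 | ⟨hfin, hcard⟩
  · exact Or.inl fun t ht => by simp [h0 t ht]
  · have hsub : {t | t ∈ Ioo (0 : ℝ) (1 / 64) ∧ G.eval t * F t = 0} ⊆
        {t | t ∈ Ioo (0 : ℝ) (1 / 64) ∧ F t = 0} ∪ (G.roots.toFinset : Set ℝ) := by
      rintro t ⟨ht, h⟩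
      rcases mul_eq_zero.1 h with h | h
      · exact Or.inr (by simpa [hG] using h)
      · exact Or.inl ⟨ht, h⟩
    have hfin' := hfin.union G.roots.toFinset.finite_toSet
    refine Or.inr ⟨hfin'.subset hsub, (ncard_le_ncard hsub hfin').trans
      ((ncard_union_le _ _).trans (add_le_add hcard ?_))⟩
    rw [ncard_coe_finset]
    exact (Multiset.toFinset_card_le _).trans (Polynomial.card_roots' G)

/-- A Picard-Fuchs system: `k` and `e` play the role of complete elliptic integrals of the first
and second kind, `w` of one of the third kind. -/
structure PicardFuchs (k e w : ℝ → ℝ) : Prop where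
  ne_zero : ∀ t ∈ Ioo (0 : ℝ) (1 / 64), k t ≠ 0
  deriv_k : ∀ t ∈ Ioo (0 : ℝ) (1 / 64),
    HasDerivAt k ((16 * t * k t - e t) / (t * (1 - 64 * t))) t
  deriv_e : ∀ t ∈ Ioo (0 : ℝ) (1 / 64), HasDerivAt e (4 * (k t - 4 * e t) / (1 - 64 * t)) t
  deriv_w : ∀ t ∈ Ioo (0 : ℝ) (1 / 64),
    HasDerivAt w ((k t - 4 * e t) / (√t * (1 - 64 * t))) t

namespace PicardFuchs

open Polynomial

variable {k e w : ℝ → ℝ}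

/-- The polynomial measuring the contact of the Riccati equation of `e / k` with `-B / A`. -/
noncomputable def contact (A B : ℝ[X]) : ℝ[X] :=
  X * (1 - C 64 * X) * (derivative B * A - B * derivative A) + B * B + C 32 * X * (A * B)
    + C 4 * X * (A * A)

/-- The coefficient of the linear part of the equation satisfied by `A e + B k`. -/
noncomputable def linearPart (A B : ℝ[X]) : ℝ[X] :=
  X * (1 - C 64 * X) * derivative A - C 16 * X * A - B

lemma natDegree_X_mul_derivative_le (A : ℝ[X]) : (X * derivative A).natDegree ≤ A.natDegree := by
  by_cases h : A.natDegree = 0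
  · rw [natDegree_eq_zero] at h
    obtain ⟨c, rfl⟩ := h
    simp
  · have := natDegree_mul_le (p := X) (q := derivative A)
    have h2 := natDegree_derivative_le A
    rw [natDegree_X] at this
    omega

lemma natDegree_one_sub_le : (1 - C 64 * X : ℝ[X]).natDegree ≤ 1 := by
  compute_degree

lemma natDegree_contact_le {A B : ℝ[X]} {D : ℕ} (hA : A.natDegree ≤ D) (hB : B.natDegree ≤ D) :
    (contact A B).natDegree ≤ 2 * D + 1 := by
  have e1 : contact A B = (1 - C 64 * X) * ((X * derivative B) * A - B * (X * derivative A))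
      + B * B + C 32 * X * (A * B) + C 4 * X * (A * A) := by
    unfold contact
    ring
  have hA' := (natDegree_X_mul_derivative_le A).trans hA
  have hB' := (natDegree_X_mul_derivative_le B).trans hB
  have hc : ∀ c : ℝ, (C c * X).natDegree ≤ 1 := fun c => by compute_degree
  have hAB : ∀ P Q : ℝ[X], P.natDegree ≤ D → Q.natDegree ≤ D → (P * Q).natDegree ≤ 2 * D :=
    fun P Q hP hQ => natDegree_mul_le.trans (by omega)
  have h1 : ∀ P Q : ℝ[X], P.natDegree ≤ 1 → Q.natDegree ≤ 2 * D → (P * Q).natDegree ≤ 2 * D + 1 :=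
    fun P Q hP hQ => natDegree_mul_le.trans (by omega)
  rw [e1]
  refine natDegree_add_le_of_degree_le (natDegree_add_le_of_degree_le
    (natDegree_add_le_of_degree_le (h1 _ _ natDegree_one_sub_le
      ((natDegree_sub_le_of_le (hAB _ _ hB' hA) (hAB _ _ hB hA')).trans (by simp))) ?_) ?_) ?_
  · exact (hAB _ _ hB hB).trans (by omega)
  · exact h1 _ _ (hc _) (hAB _ _ hA hB)
  · exact h1 _ _ (hc _) (hAB _ _ hA hA)

lemma hasDerivAt_combination (h : PicardFuchs k e w) (A B : ℝ[X]) {t : ℝ}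
    (ht : t ∈ Ioo (0 : ℝ) (1 / 64)) :
    HasDerivAt (fun t => A.eval t * e t + B.eval t * k t)
      (((linearPart A B).eval t * e t + ((X * (1 - C 64 * X) * derivative B + C 4 * X * A
        + C 16 * X * B).eval t) * k t) / (t * (1 - 64 * t))) t := by
  have h1 : t ≠ 0 := ht.1.ne'
  have h2 : 1 - 64 * t ≠ 0 := by linarith [ht.2]
  refine (((A.hasDerivAt t).mul (h.deriv_e t ht)).add
    ((B.hasDerivAt t).mul (h.deriv_k t ht))).congr_deriv ?_
  simp only [linearPart, eval_add, eval_sub, eval_mul, eval_X, eval_C, eval_one]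
  field_simp
  ring

lemma zerosLE_of_isCoprime (h : PicardFuchs k e w) {A B : ℝ[X]} (hAB : IsCoprime A B) {D : ℕ}
    (hA : A.natDegree ≤ D) (hB : B.natDegree ≤ D) :
    ZerosLE (fun t => A.eval t * e t + B.eval t * k t) (3 * D + 2) := by
  by_cases hA0 : A = 0
  · subst hA0
    obtain ⟨b, hb, rfl⟩ := Polynomial.isUnit_iff.1 (isCoprime_zero_left.1 hAB)
    exact zerosLE_of_no_zeros _ fun t ht => by simpa [hb.ne_zero] using h.ne_zero t ht
  have hroot : ∀ t ∈ Ioo (0 : ℝ) (1 / 64), A.eval t * e t + B.eval t * k t = 0 →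
      A.eval t ≠ 0 := by
    intro t ht hF hAt
    have hBt : B.eval t = 0 := by simpa [hAt, h.ne_zero t ht] using hF
    obtain ⟨u, v, huv⟩ := hAB
    simpa [hAt, hBt] using congrArg (eval t) huv
  by_cases hM : contact A B = 0
  · have hlin : (linearPart A B) * B = A * (X * (1 - C 64 * X) * derivative B + C 4 * X * A
        + C 16 * X * B) := by
      unfold contact at hM
      unfold linearPart
      have h32 : (C 32 : ℝ[X]) = C 16 + C 16 := by rw [← C_add]; norm_num
      rw [h32] at hM
      linear_combination -hM
    obtain ⟨S, hS⟩ : A ∣ linearPart A B := hAB.dvd_of_dvd_mul_right ⟨_, hlin⟩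
    have hS' : X * (1 - C 64 * X) * derivative B + C 4 * X * A + C 16 * X * B = S * B := by
      apply mul_left_cancel₀ hA0
      rw [← hlin, hS]
      ring
    have hd : ∀ t ∈ Ioo (0 : ℝ) (1 / 64),
        HasDerivAt (fun t => A.eval t * e t + B.eval t * k t)
          (S.eval t / (t * (1 - 64 * t)) * (A.eval t * e t + B.eval t * k t)) t := by
      intro t ht
      refine (h.hasDerivAt_combination A B ht).congr_deriv ?_
      rw [hS', hS, eval_mul, eval_mul]
      ring
    have hcont : ContinuousOn (fun t => S.eval t / (t * (1 - 64 * t))) (Ioo (0 : ℝ) (1 / 64)) := by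
      refine S.continuous.continuousOn.div (by fun_prop) fun t ht => ?_
      have h1 : t ≠ 0 := ht.1.ne'
      have h2 : 1 - 64 * t ≠ 0 := by linarith [ht.2]
      positivity
    have hiff : ∀ a ∈ Ioo (0 : ℝ) (1 / 64), ∀ b ∈ Ioo (0 : ℝ) (1 / 64), a ≤ b →
        (A.eval a * e a + B.eval a * k a = 0 ↔ A.eval b * e b + B.eval b * k b = 0) := by
      intro a ha b hb hab
      have hsub : Icc a b ⊆ Ioo (0 : ℝ) (1 / 64) :=
        fun x hx => ⟨ha.1.trans_le hx.1, hx.2.trans_lt hb.2⟩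
      exact eq_zero_iff_of_linear_ode hab (hcont.mono hsub) fun x hx => hd x (hsub hx)
    by_cases hz : ∃ t ∈ Ioo (0 : ℝ) (1 / 64), A.eval t * e t + B.eval t * k t = 0
    · obtain ⟨t, ht, hFt⟩ := hz
      refine Or.inl fun x hx => ?_
      rcases le_total t x with htx | htx
      · exact (hiff t ht x hx htx).1 hFt
      · exact (hiff x hx t ht htx).2 hFt
    · push Not at hz
      exact zerosLE_of_no_zeros _ hz
  · have hP : A * contact A B ≠ 0 := mul_ne_zero hA0 hM
    have hsep := finite_and_ncard_le_of_separated
      (S := {t | t ∈ Ioo (0 : ℝ) (1 / 64) ∧ A.eval t * e t + B.eval t * k t = 0})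
      (A * contact A B).roots.toFinset.finite_toSet ?_
    · refine Or.inr ⟨hsep.1, hsep.2.trans ?_⟩
      rw [ncard_coe_finset]
      have h1 := (Multiset.toFinset_card_le _).trans (A * contact A B).card_roots'
      have h2 := natDegree_mul_le (p := A) (q := contact A B)
      have h3 := natDegree_contact_le hA hB
      omega
    · rintro a ⟨ha, hFa⟩ b ⟨hb, hFb⟩ hab
      have hsub : Icc a b ⊆ Ioo (0 : ℝ) (1 / 64) :=
        fun x hx => ⟨ha.1.trans_le hx.1, hx.2.trans_lt hb.2⟩
      by_cases hAz : ∃ c ∈ Icc a b, A.eval c = 0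
      · obtain ⟨c, hc, hAc⟩ := hAz
        have hac : a ≠ c := fun hac => hroot a ha hFa (hac ▸ hAc)
        have hcb : c ≠ b := fun hcb => hroot b hb hFb (hcb ▸ hAc)
        exact ⟨c, by simp [hA0, hM, hAc], lt_of_le_of_ne hc.1 hac, lt_of_le_of_ne hc.2 hcb⟩
      push Not at hAz
      have hpos : ∀ t ∈ Icc a b, t ≠ 0 ∧ 1 - 64 * t ≠ 0 := fun t ht =>
        ⟨(hsub ht).1.ne', by linarith [(hsub ht).2]⟩
      have hcont : ContinuousOn
          (fun t => (linearPart A B).eval t / (A.eval t * (t * (1 - 64 * t)))) (Icc a b) := by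
        refine (linearPart A B).continuous.continuousOn.div
          (A.continuous.continuousOn.mul (by fun_prop)) fun t ht => ?_
        exact mul_ne_zero (hAz t ht) (mul_ne_zero (hpos t ht).1 (hpos t ht).2)
      obtain ⟨c, hc, hc0⟩ := exists_zero_of_linear_ode hab hcont
        (r := fun t => (contact A B).eval t * k t / (A.eval t * (t * (1 - 64 * t))))
        (F := fun t => A.eval t * e t + B.eval t * k t) (fun t ht => by
          refine (h.hasDerivAt_combination A B (hsub ht)).congr_deriv ?_
          have h0 := hAz t ht
          obtain ⟨h1, h2⟩ := hpos t ht
          simp only [linearPart, contact, eval_add, eval_sub, eval_mul, eval_X, eval_C, eval_one]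
          field_simp
          ring) hFa hFb
      have hc' := Ioo_subset_Icc_self hc
      have h0 := hAz c hc'
      obtain ⟨h1, h2⟩ := hpos c hc'
      have hcc : (contact A B).eval c = 0 := by
        simpa [h0, h1, h2, h.ne_zero c (hsub hc')] using hc0
      exact ⟨c, by simp [hA0, hM, hcc], hc⟩

lemma zerosLE_combination (h : PicardFuchs k e w) {A B : ℝ[X]} {D : ℕ}
    (hA : A.natDegree ≤ D) (hB : B.natDegree ≤ D) :
    ZerosLE (fun t => A.eval t * e t + B.eval t * k t) (3 * D + 2) := by
  by_cases h0 : A = 0 ∧ B = 0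
  · exact Or.inl fun t _ => by simp [h0.1, h0.2]
  obtain ⟨A', B', hA', hB', hunit⟩ := extract_gcd A B
  set G := gcd A B with hG
  have hG0 : G ≠ 0 := by
    intro h
    exact h0 ((gcd_eq_zero_iff A B).1 h)
  have hcop : IsCoprime A' B' := (gcd_isUnit_iff A' B').1 hunit
  have hdeg : ∀ P : ℝ[X], (G * P).natDegree ≤ D → P.natDegree ≤ D - G.natDegree := by
    intro P hP
    by_cases hP0 : P = 0
    · simp [hP0]
    · rw [natDegree_mul hG0 hP0] at hP
      omega
  have hGD : G.natDegree ≤ D := by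
    by_cases hA0 : A = 0
    · have hB0 : B ≠ 0 := fun hB0 => h0 ⟨hA0, hB0⟩
      exact (natDegree_le_of_dvd (gcd_dvd_right A B) hB0).trans hB
    · exact (natDegree_le_of_dvd (gcd_dvd_left A B) hA0).trans hA
  have := (h.zerosLE_of_isCoprime hcop (hdeg A' (hA' ▸ hA)) (hdeg B' (hB' ▸ hB))).polynomial_mul hG0
  refine (this.mono (by omega)).congr fun t _ => ?_
  rw [hA', hB', eval_mul, eval_mul]
  simp only [mul_add, mul_assoc]

/-- Repeated differentiation lowers the degree of the coefficient of the third kind integral. -/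
lemma zerosLE_with_third_kind (h : PicardFuchs k e w) (m : ℕ) : ∀ (j : ℕ) (P A B : ℝ[X]),
    P.degree < m → A.natDegree ≤ m + 2 * j → B.natDegree ≤ m + 2 * j →
    ZerosLE (fun t => P.eval t * w t +
      (A.eval t * e t + B.eval t * k t) / (√t * (t * (1 - 64 * t)) ^ j)) (7 * m + 6 * j + 2) := by
  induction m with
  | zero =>
    intro j P A B hP hA hB
    have hP0 : P = 0 := by simpa using hP
    refine ((h.zerosLE_combination hA hB).mono (by omega)).congr fun t ht => ?_
    have h1 : t ≠ 0 := ht.1.ne'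
    have h2 : 1 - 64 * t ≠ 0 := by linarith [ht.2]
    have h3 : √t ≠ 0 := (Real.sqrt_pos.2 ht.1).ne'
    simp [hP0, h1, h2, h3]
  | succ m ih =>
    intro j P A B hP hA hB
    set T : ℝ[X] := X * (1 - C 64 * X) with hT
    set q : ℝ[X] := C ((j : ℝ) + 1 / 2) * (1 - C 64 * X) - C (64 * (j : ℝ)) * X with hq
    have hT2 : T.natDegree ≤ 2 := natDegree_mul_le.trans
      (by have := natDegree_one_sub_le; rw [natDegree_X]; omega)
    have hq1 : q.natDegree ≤ 1 := by rw [hq]; compute_degree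
    have hX : ∀ c : ℝ, (C c * X).natDegree ≤ 1 := fun c => by compute_degree
    have hmul : ∀ F G : ℝ[X], F.natDegree ≤ 1 → G.natDegree ≤ m + 1 + 2 * j →
        (F * G).natDegree ≤ m + 2 * (j + 1) := fun F G hF hG =>
      natDegree_mul_le.trans (by omega)
    have hTd : ∀ F : ℝ[X], F.natDegree ≤ m + 1 + 2 * j →
        (T * derivative F).natDegree ≤ m + 2 * (j + 1) := fun F hF => by
      have : T * derivative F = (1 - C 64 * X) * (X * derivative F) := by rw [hT]; ring
      rw [this]
      exact hmul _ _ natDegree_one_sub_le ((natDegree_X_mul_derivative_le F).trans hF)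
    have hPT : ∀ c : ℝ, (C c * X * P * T ^ j).natDegree ≤ m + 2 * (j + 1) := fun c => by
      have h1 : P.natDegree ≤ m := by
        by_cases hP0 : P = 0
        · simp [hP0]
        · exact Nat.lt_succ_iff.1 ((natDegree_lt_iff_degree_lt hP0).2 hP)
      have h2 : (T ^ j).natDegree ≤ j * 2 := natDegree_pow_le_of_le j hT2
      have h3 := natDegree_mul_le (p := C c * X * P) (q := T ^ j)
      have h4 := natDegree_mul_le (p := C c * X) (q := P)
      have h5 := hX c
      omega
    have hB' : B.natDegree ≤ m + 2 * (j + 1) := hB.trans (by omega)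
    have hP' : (derivative P).degree < m := by
      by_cases hP0 : P = 0
      · simp [hP0]
      · have h1 := degree_derivative_lt hP0
        have h2 : P.degree ≤ m := by
          rw [degree_eq_natDegree hP0] at hP ⊢
          exact_mod_cast Nat.lt_succ_iff.1 (by exact_mod_cast hP)
        exact h1.trans_le h2
    have key := ih (j + 1) (derivative P)
      (T * derivative A - C 16 * X * A - B - q * A - C 4 * X * P * T ^ j)
      (T * derivative B + C 4 * X * A + C 16 * X * B - q * B + C 1 * X * P * T ^ j) hP'
      (by
        have := natDegree_sub_le_of_le (natDegree_sub_le_of_le (natDegree_sub_le_of_le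
          (natDegree_sub_le_of_le (hTd A hA) (hmul _ _ (hX 16) hA)) hB') (hmul _ _ hq1 hA)) (hPT 4)
        simpa using this)
      (by
        have := natDegree_add_le_of_le (natDegree_sub_le_of_le (natDegree_add_le_of_le
          (natDegree_add_le_of_le (hTd B hB) (hmul _ _ (hX 4) hA)) (hmul _ _ (hX 16) hB))
          (hmul _ _ hq1 hB)) (hPT 1)
        simpa using this)
    refine (key.of_deriv (f := fun t => P.eval t * w t +
      (A.eval t * e t + B.eval t * k t) / (√t * (t * (1 - 64 * t)) ^ j)) fun t ht => ?_).mono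
        (by omega)
    have h1 : t ≠ 0 := ht.1.ne'
    have h2 : 1 - 64 * t ≠ 0 := by linarith [ht.2]
    have h3 : √t ≠ 0 := (Real.sqrt_pos.2 ht.1).ne'
    have hden : HasDerivAt (fun t : ℝ => √t * (t * (1 - 64 * t)) ^ j)
        (√t * (t * (1 - 64 * t)) ^ j * (q.eval t / (t * (1 - 64 * t)))) t := by
      have hs := Real.hasDerivAt_sqrt h1
      have hp : HasDerivAt (fun t : ℝ => t * (1 - 64 * t)) (1 - 128 * t) t := by
        have := (hasDerivAt_id t).mul (((hasDerivAt_id t).const_mul 64).const_sub 1)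
        exact this.congr_deriv (by simp only [id]; ring)
      refine (hs.mul (hp.pow j)).congr_deriv ?_
      have hsq : √t ^ 2 = t := Real.sq_sqrt ht.1.le
      simp only [hq, eval_sub, eval_mul, eval_C, eval_one, eval_X]
      rcases j with _ | j
      · field_simp
        simp [hsq]
      · simp only [Nat.add_sub_cancel, Nat.cast_add, Nat.cast_one, pow_succ, Pi.pow_apply]
        generalize (t * (1 - 64 * t)) ^ j = y
        rw [← mul_div_assoc, eq_div_iff (mul_ne_zero h1 h2)]
        field_simp
        rw [hsq]
        ring
    have hden0 : √t * (t * (1 - 64 * t)) ^ j ≠ 0 := by positivity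
    have hnum := h.hasDerivAt_combination A B ht
    refine (((P.hasDerivAt t).mul (h.deriv_w t ht)).add (hnum.div hden hden0)).congr_deriv ?_
    simp only [linearPart, hT, eval_add, eval_sub, eval_mul, eval_pow, eval_X, eval_C, eval_one]
    field_simp
    ring

end PicardFuchs

/-- Differentiation under the integral sign for jointly continuous derivatives. -/
lemma hasDerivAt_integral_of_continuousOn {F F' : ℝ → ℝ → ℝ} {U : Set ℝ} (hU : IsOpen U)
    {a b s : ℝ} (hs : s ∈ U) (hF : ∀ s ∈ U, Continuous (F s))
    (hF' : ContinuousOn (fun p : ℝ × ℝ => F' p.1 p.2) (U ×ˢ univ))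
    (hd : ∀ s ∈ U, ∀ θ, HasDerivAt (fun s => F s θ) (F' s θ) s) :
    HasDerivAt (fun s => ∫ θ in a..b, F s θ) (∫ θ in a..b, F' s θ) s := by
  obtain ⟨ε, hε, hball⟩ := Metric.nhds_basis_closedBall.mem_iff.1 (hU.mem_nhds hs)
  have hcont : ∀ s ∈ U, Continuous (F' s) := fun s hs =>
    continuousOn_univ.1 (hF'.comp (by fun_prop : ContinuousOn (fun θ => (s, θ)) univ)
      fun θ _ => ⟨hs, mem_univ _⟩)
  obtain ⟨M, hM⟩ := ((isCompact_closedBall s ε).prod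
    (isCompact_uIcc (a := a) (b := b))).exists_bound_of_continuousOn
      (hF'.mono (prod_mono hball (subset_univ _)))
  refine (intervalIntegral.hasDerivAt_integral_of_dominated_loc_of_deriv_le
    (bound := fun _ => M) (Metric.closedBall_mem_nhds s hε) ?_ ((hF s hs).intervalIntegrable _ _)
    (hcont s hs).aestronglyMeasurable ?_ intervalIntegrable_const ?_).2
  · filter_upwards [hU.mem_nhds hs] with u hu using (hF u hu).aestronglyMeasurable
  · exact .of_forall fun θ hθ u hu => hM (u, θ) ⟨hu, uIoc_subset_uIcc hθ⟩
  · exact .of_forall fun θ _ u hu => hd u (hball hu) θ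

/-- The product `x (1 - x)` along the oval `{H = s ^ 2}`, parametrised by an angle. -/
noncomputable def ovalProd (s θ : ℝ) : ℝ := 1 / 4 - (1 / 4 - 2 * s) * Real.cos θ ^ 2

/-- The abscissa along the oval `{H = s ^ 2}`. -/
noncomputable def ovalX (s θ : ℝ) : ℝ := 1 / 2 + √(1 / 4 - 2 * s) * Real.cos θ

/-- The density `dx / √(x²(1-x)² - 4s²)` in the angular parameter. -/
noncomputable def density (s θ : ℝ) : ℝ := (√(ovalProd s θ + 2 * s))⁻¹

noncomputable def firstKind (s : ℝ) : ℝ := ∫ θ in (0)..Real.pi, density s θ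

noncomputable def secondKind (s : ℝ) : ℝ := ∫ θ in (0)..Real.pi, ovalProd s θ * density s θ

noncomputable def thirdKind (s : ℝ) : ℝ := ∫ θ in (0)..Real.pi, s * (ovalProd s θ)⁻¹ * density s θ

section Oval

variable {s : ℝ}

lemma two_mul_le_ovalProd (hs : s ∈ Ioo (0 : ℝ) (1 / 8)) (θ : ℝ) : 2 * s ≤ ovalProd s θ := by
  have h1 : 0 ≤ (1 / 4 - 2 * s) * (1 - Real.cos θ ^ 2) :=
    mul_nonneg (by linarith [hs.2]) (by linarith [Real.cos_sq_le_one θ])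
  unfold ovalProd
  linarith

lemma ovalProd_pos (hs : s ∈ Ioo (0 : ℝ) (1 / 8)) (θ : ℝ) : 0 < ovalProd s θ := by
  linarith [two_mul_le_ovalProd hs θ, hs.1]

lemma ovalProd_add_pos (hs : s ∈ Ioo (0 : ℝ) (1 / 8)) (θ : ℝ) : 0 < ovalProd s θ + 2 * s := by
  linarith [two_mul_le_ovalProd hs θ, hs.1]

lemma density_pos (hs : s ∈ Ioo (0 : ℝ) (1 / 8)) (θ : ℝ) : 0 < density s θ :=
  inv_pos.2 (Real.sqrt_pos.2 (ovalProd_add_pos hs θ))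

lemma ovalX_mul (hs : s ∈ Ioo (0 : ℝ) (1 / 8)) (θ : ℝ) :
    ovalX s θ * (1 - ovalX s θ) = ovalProd s θ := by
  have h := Real.sq_sqrt (show 0 ≤ 1 / 4 - 2 * s by linarith [hs.2])
  unfold ovalX ovalProd
  linear_combination (-Real.cos θ ^ 2) * h

lemma ovalX_pos (hs : s ∈ Ioo (0 : ℝ) (1 / 8)) (θ : ℝ) : 0 < ovalX s θ := by
  have h := ovalX_mul hs θ
  have h2 := ovalProd_pos hs θ
  by_contra! hx
  nlinarith

lemma continuous_ovalProd (s : ℝ) : Continuous (ovalProd s) := by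
  unfold ovalProd
  fun_prop

lemma continuous_ovalX (s : ℝ) : Continuous (ovalX s) := by
  unfold ovalX
  fun_prop

lemma continuous_density (hs : s ∈ Ioo (0 : ℝ) (1 / 8)) : Continuous (density s) := by
  have := continuous_ovalProd s
  exact Continuous.inv₀ (by fun_prop) fun θ => (Real.sqrt_pos.2 (ovalProd_add_pos hs θ)).ne'

lemma continuous_inv_ovalProd (hs : s ∈ Ioo (0 : ℝ) (1 / 8)) :
    Continuous fun θ => (ovalProd s θ)⁻¹ :=
  (continuous_ovalProd s).inv₀ fun θ => (ovalProd_pos hs θ).ne'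

lemma hasDerivAt_inv_sqrt {f : ℝ → ℝ} {f' x : ℝ} (hf : HasDerivAt f f' x) (h : 0 < f x) :
    HasDerivAt (fun x => (√(f x))⁻¹) (-(f' / (2 * f x)) * (√(f x))⁻¹) x := by
  have h0 := (Real.sqrt_pos.2 h).ne'
  refine ((hf.sqrt h.ne').inv h0).congr_deriv ?_
  have hsq := Real.sq_sqrt h.le
  field_simp
  rw [hsq]

lemma hasDerivAt_ovalProd (s θ : ℝ) :
    HasDerivAt (ovalProd s) (2 * (1 / 4 - 2 * s) * (Real.sin θ * Real.cos θ)) θ := by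
  have := (((Real.hasDerivAt_cos θ).pow 2).const_mul (1 / 4 - 2 * s)).const_sub (1 / 4)
  exact this.congr_deriv (by simp; ring)

lemma hasDerivAt_density (hs : s ∈ Ioo (0 : ℝ) (1 / 8)) (θ : ℝ) :
    HasDerivAt (density s) (-((1 / 4 - 2 * s) * (Real.sin θ * Real.cos θ) /
      (ovalProd s θ + 2 * s)) * density s θ) θ := by
  have h := hasDerivAt_inv_sqrt ((hasDerivAt_ovalProd s θ).add_const (2 * s))
    (ovalProd_add_pos hs θ)
  have h0 := (ovalProd_add_pos hs θ).ne'
  exact h.congr_deriv (by rw [density]; field_simp)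

lemma hasDerivAt_ovalProd_param (s θ : ℝ) :
    HasDerivAt (fun s => ovalProd s θ) (2 * Real.cos θ ^ 2) s := by
  have := (((((hasDerivAt_id s).const_mul 2).const_sub (1 / 4)).mul_const
    (Real.cos θ ^ 2)).const_sub (1 / 4))
  exact this.congr_deriv (by ring)

lemma hasDerivAt_density_param (hs : s ∈ Ioo (0 : ℝ) (1 / 8)) (θ : ℝ) :
    HasDerivAt (fun s => density s θ) (-((1 + Real.cos θ ^ 2) /
      (ovalProd s θ + 2 * s)) * density s θ) s := by
  have h := hasDerivAt_inv_sqrt ((hasDerivAt_ovalProd_param s θ).add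
    ((hasDerivAt_id s).const_mul 2)) (ovalProd_add_pos hs θ)
  have h0 := (ovalProd_add_pos hs θ).ne'
  refine h.congr_deriv ?_
  simp only [density, Pi.add_apply, id]
  field_simp
  ring

lemma continuousOn_ovalProd_uncurried :
    ContinuousOn (fun p : ℝ × ℝ => ovalProd p.1 p.2) (Ioo (0 : ℝ) (1 / 8) ×ˢ univ) := by
  unfold ovalProd
  fun_prop

lemma continuousOn_inv_ovalProd_uncurried :
    ContinuousOn (fun p : ℝ × ℝ => (ovalProd p.1 p.2)⁻¹) (Ioo (0 : ℝ) (1 / 8) ×ˢ univ) :=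
  continuousOn_ovalProd_uncurried.inv₀ fun p hp => (ovalProd_pos hp.1 p.2).ne'

lemma continuousOn_inv_ovalProd_add_uncurried :
    ContinuousOn (fun p : ℝ × ℝ => (ovalProd p.1 p.2 + 2 * p.1)⁻¹)
      (Ioo (0 : ℝ) (1 / 8) ×ˢ univ) :=
  (continuousOn_ovalProd_uncurried.add (by fun_prop)).inv₀
    fun p hp => (ovalProd_add_pos hp.1 p.2).ne'

lemma continuousOn_density_uncurried :
    ContinuousOn (fun p : ℝ × ℝ => density p.1 p.2) (Ioo (0 : ℝ) (1 / 8) ×ˢ univ) :=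
  ((continuousOn_ovalProd_uncurried.add (by fun_prop)).sqrt).inv₀
    fun p hp => (Real.sqrt_pos.2 (ovalProd_add_pos hp.1 p.2)).ne'

lemma integral_eq_zero_of_hasDerivAt {G g : ℝ → ℝ} (hg : Continuous g)
    (hG : ∀ θ, HasDerivAt G (g θ) θ) (h0 : G 0 = 0) (hpi : G Real.pi = 0) :
    ∫ θ in (0)..Real.pi, g θ = 0 := by
  rw [intervalIntegral.integral_eq_sub_of_hasDerivAt (fun θ _ => hG θ)
    (hg.intervalIntegrable _ _), h0, hpi, sub_zero]

lemma hasDerivAt_sin_mul_cos (θ : ℝ) :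
    HasDerivAt (fun θ => Real.sin θ * Real.cos θ) (2 * Real.cos θ ^ 2 - 1) θ := by
  refine ((Real.hasDerivAt_sin θ).mul (Real.hasDerivAt_cos θ)).congr_deriv ?_
  linear_combination (-1 : ℝ) * Real.sin_sq_add_cos_sq θ

/-- If the parameter derivative of `F` equals a combination of densities up to an exact form, so
does the derivative of the integral. -/
lemma hasDerivAt_integral_of_exact {F F' : ℝ → ℝ → ℝ} (hs : s ∈ Ioo (0 : ℝ) (1 / 8))
    (hF : ∀ s ∈ Ioo (0 : ℝ) (1 / 8), Continuous (F s))
    (hF' : ContinuousOn (fun p : ℝ × ℝ => F' p.1 p.2) (Ioo (0 : ℝ) (1 / 8) ×ˢ univ))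
    (hd : ∀ s ∈ Ioo (0 : ℝ) (1 / 8), ∀ θ, HasDerivAt (fun s => F s θ) (F' s θ) s)
    {G : ℝ → ℝ} {d a b : ℝ} (hd0 : d ≠ 0)
    (hG : ∀ θ, HasDerivAt G
      (d * F' s θ - (a * density s θ + b * (ovalProd s θ * density s θ))) θ)
    (h0 : G 0 = 0) (hpi : G Real.pi = 0) :
    HasDerivAt (fun s => ∫ θ in (0)..Real.pi, F s θ)
      ((a * firstKind s + b * secondKind s) / d) s := by
  have h := hasDerivAt_integral_of_continuousOn (a := 0) (b := Real.pi) isOpen_Ioo hs hF hF' hd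
  have c0 := continuous_density hs
  have c1 := continuous_ovalProd s
  have c2 : Continuous (F' s) :=
    continuousOn_univ.1 (hF'.comp (by fun_prop : ContinuousOn (fun θ => (s, θ)) univ)
      fun θ _ => ⟨hs, mem_univ _⟩)
  have key := integral_eq_zero_of_hasDerivAt (by fun_prop) hG h0 hpi
  have i0 := c0.intervalIntegrable (μ := volume) 0 Real.pi
  have i1 : IntervalIntegrable (fun θ => ovalProd s θ * density s θ) volume 0 Real.pi :=
    (c1.mul c0).intervalIntegrable _ _
  have i2 := c2.intervalIntegrable (μ := volume) 0 Real.pi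
  rw [intervalIntegral.integral_sub (i2.const_mul d) ((i0.const_mul a).add (i1.const_mul b)),
    intervalIntegral.integral_add (i0.const_mul a) (i1.const_mul b),
    intervalIntegral.integral_const_mul, intervalIntegral.integral_const_mul,
    intervalIntegral.integral_const_mul] at key
  refine h.congr_deriv ?_
  rw [eq_div_iff hd0]
  unfold firstKind secondKind
  linarith

lemma hasDerivAt_firstKind (hs : s ∈ Ioo (0 : ℝ) (1 / 8)) :
    HasDerivAt firstKind
      ((32 * s ^ 2 * firstKind s + -2 * secondKind s) / (s * (1 - 64 * s ^ 2))) s := by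
  have h1 : s ≠ 0 := hs.1.ne'
  have h2 : 1 - 64 * s ^ 2 ≠ 0 := by nlinarith [hs.1, hs.2]
  refine hasDerivAt_integral_of_exact hs (fun s hs => continuous_density hs)
    (F' := fun s θ => -((1 + Real.cos θ ^ 2) / (ovalProd s θ + 2 * s)) * density s θ)
    ?_ (fun s hs θ => hasDerivAt_density_param hs θ) (mul_ne_zero h1 h2)
    (G := fun θ => -2 * (1 / 4 - 2 * s) * (Real.sin θ * Real.cos θ * density s θ))
    (fun θ => ?_) (by simp) (by simp)
  · simp only [div_eq_mul_inv]
    exact ((ContinuousOn.mul (by fun_prop) continuousOn_inv_ovalProd_add_uncurried).neg).mul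
      continuousOn_density_uncurried
  · refine (((hasDerivAt_sin_mul_cos θ).mul (hasDerivAt_density hs θ)).const_mul _).congr_deriv ?_
    have h0 := (ovalProd_add_pos hs θ).ne'
    have hsin := Real.sin_sq θ
    field_simp
    rw [hsin]
    unfold ovalProd
    ring

lemma hasDerivAt_secondKind (hs : s ∈ Ioo (0 : ℝ) (1 / 8)) :
    HasDerivAt secondKind
      ((8 * s * firstKind s + -32 * s * secondKind s) / (1 - 64 * s ^ 2)) s := by
  have h2 : 1 - 64 * s ^ 2 ≠ 0 := by nlinarith [hs.1, hs.2]
  refine hasDerivAt_integral_of_exact hs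
    (fun s hs => (continuous_ovalProd s).mul (continuous_density hs))
    (F' := fun s θ => 2 * Real.cos θ ^ 2 * density s θ +
      ovalProd s θ * (-((1 + Real.cos θ ^ 2) / (ovalProd s θ + 2 * s)) * density s θ))
    ?_ (fun s hs θ => (hasDerivAt_ovalProd_param s θ).mul (hasDerivAt_density_param hs θ)) h2
    (G := fun θ => 4 * (1 / 4 - 2 * s) * (Real.sin θ * Real.cos θ * density s θ))
    (fun θ => ?_) (by simp) (by simp)
  · simp only [div_eq_mul_inv]
    exact (ContinuousOn.mul (by fun_prop) continuousOn_density_uncurried).add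
      (continuousOn_ovalProd_uncurried.mul (((ContinuousOn.mul (by fun_prop)
        continuousOn_inv_ovalProd_add_uncurried).neg).mul continuousOn_density_uncurried))
  · refine (((hasDerivAt_sin_mul_cos θ).mul (hasDerivAt_density hs θ)).const_mul _).congr_deriv ?_
    have h0 := (ovalProd_add_pos hs θ).ne'
    have hsin := Real.sin_sq θ
    field_simp
    rw [hsin]
    unfold ovalProd
    ring

lemma hasDerivAt_thirdKind (hs : s ∈ Ioo (0 : ℝ) (1 / 8)) :
    HasDerivAt thirdKind
      ((2 * firstKind s + -8 * secondKind s) / (1 - 64 * s ^ 2)) s := by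
  have h2 : 1 - 64 * s ^ 2 ≠ 0 := by nlinarith [hs.1, hs.2]
  refine hasDerivAt_integral_of_exact hs
    (fun s hs => (continuous_const.mul (continuous_inv_ovalProd hs)).mul (continuous_density hs))
    (F' := fun s θ => ((ovalProd s θ)⁻¹ - s * (2 * Real.cos θ ^ 2 * (ovalProd s θ)⁻¹ ^ 2)) *
      density s θ + s * (ovalProd s θ)⁻¹ *
        (-((1 + Real.cos θ ^ 2) / (ovalProd s θ + 2 * s)) * density s θ))
    ?_ (fun s hs θ => ?_) h2
    (G := fun θ => Real.sin θ * Real.cos θ * density s θ *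
      (-(1 - 64 * s ^ 2) / 2 * (ovalProd s θ)⁻¹ - 8 * (1 / 4 - 2 * s)))
    (fun θ => ?_) (by simp) (by simp)
  · simp only [div_eq_mul_inv]
    have hz := continuousOn_inv_ovalProd_uncurried
    exact ((hz.sub (ContinuousOn.mul (by fun_prop) (ContinuousOn.mul (by fun_prop)
      (hz.pow 2)))).mul continuousOn_density_uncurried).add
      ((ContinuousOn.mul (by fun_prop) hz).mul (((ContinuousOn.mul (by fun_prop)
        continuousOn_inv_ovalProd_add_uncurried).neg).mul continuousOn_density_uncurried))
  · have hz := (ovalProd_pos hs θ).ne'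
    refine (((hasDerivAt_id s).mul ((hasDerivAt_ovalProd_param s θ).inv hz)).mul
      (hasDerivAt_density_param hs θ)).congr_deriv ?_
    simp only [id, Pi.mul_apply, Pi.inv_apply]
    field_simp
    ring
  · have h0 := (ovalProd_add_pos hs θ).ne'
    have hz := (ovalProd_pos hs θ).ne'
    refine (((hasDerivAt_sin_mul_cos θ).mul (hasDerivAt_density hs θ)).mul
      ((((hasDerivAt_ovalProd s θ).inv hz).const_mul _).sub_const _)).congr_deriv ?_
    have hsin := Real.sin_sq θ
    simp only [Pi.mul_apply, Pi.inv_apply]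
    field_simp
    rw [hsin]
    unfold ovalProd
    ring

lemma firstKind_pos (hs : s ∈ Ioo (0 : ℝ) (1 / 8)) : 0 < firstKind s :=
  intervalIntegral.intervalIntegral_pos_of_pos_on
    ((continuous_density hs).intervalIntegrable _ _) (fun θ _ => density_pos hs θ) Real.pi_pos

end Oval

lemma sqrt_mem_Ioo {t : ℝ} (ht : t ∈ Ioo (0 : ℝ) (1 / 64)) : √t ∈ Ioo (0 : ℝ) (1 / 8) := by
  refine ⟨Real.sqrt_pos.2 ht.1, ?_⟩
  rw [Real.sqrt_lt' (by norm_num)]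
  linarith [ht.2]

lemma picardFuchs_integrals :
    PicardFuchs (fun t => firstKind √t) (fun t => secondKind √t) (fun t => thirdKind √t) := by
  have key : ∀ t ∈ Ioo (0 : ℝ) (1 / 64), √t ≠ 0 ∧ √t ^ 2 = t ∧ 1 - 64 * t ≠ 0 ∧
      HasDerivAt (fun t => √t) (1 / (2 * √t)) t := fun t ht =>
    ⟨(sqrt_mem_Ioo ht).1.ne', Real.sq_sqrt ht.1.le, by linarith [ht.2],
      Real.hasDerivAt_sqrt ht.1.ne'⟩
  refine ⟨fun t ht => (firstKind_pos (sqrt_mem_Ioo ht)).ne', fun t ht => ?_, fun t ht => ?_,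
    fun t ht => ?_⟩ <;> obtain ⟨h1, h2, h3, hd⟩ := key t ht
  · refine ((hasDerivAt_firstKind (sqrt_mem_Ioo ht)).comp t hd).congr_deriv ?_
    have h4 := ht.1.ne'
    rw [h2]
    field_simp
    rw [h2]
    ring
  · refine ((hasDerivAt_secondKind (sqrt_mem_Ioo ht)).comp t hd).congr_deriv ?_
    rw [h2]
    field_simp
    ring
  · refine ((hasDerivAt_thirdKind (sqrt_mem_Ioo ht)).comp t hd).congr_deriv ?_
    rw [h2]
    field_simp
    ring

/-- The moments of the abscissa along the oval `{H = s ^ 2}`. -/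
noncomputable def ovalMoment (j : ℤ) (s : ℝ) : ℝ :=
  ∫ θ in (0)..Real.pi, ovalX s θ ^ j * density s θ

section Moments

variable {s : ℝ}

lemma continuous_ovalX_zpow (hs : s ∈ Ioo (0 : ℝ) (1 / 8)) (j : ℤ) :
    Continuous fun θ => ovalX s θ ^ j :=
  (continuous_ovalX s).zpow₀ j fun θ => Or.inl (ovalX_pos hs θ).ne'

lemma intervalIntegrable_moment (hs : s ∈ Ioo (0 : ℝ) (1 / 8)) (j : ℤ) :
    IntervalIntegrable (fun θ => ovalX s θ ^ j * density s θ) volume 0 Real.pi :=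
  ((continuous_ovalX_zpow hs j).mul (continuous_density hs)).intervalIntegrable _ _

lemma hasDerivAt_ovalX (s θ : ℝ) :
    HasDerivAt (ovalX s) (-(√(1 / 4 - 2 * s) * Real.sin θ)) θ :=
  (((Real.hasDerivAt_cos θ).const_mul _).const_add (1 / 2)).congr_deriv (by ring)

/-- The recursion obtained by integrating the derivative of `x ^ j * √(x²(1-x)² - 4s²)`. -/
lemma ovalMoment_recursion (hs : s ∈ Ioo (0 : ℝ) (1 / 8)) (j : ℤ) :
    (j + 2) * ovalMoment (j + 3) s - (2 * j + 3) * ovalMoment (j + 2) s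
      + (j + 1) * ovalMoment (j + 1) s = 4 * s ^ 2 * j * ovalMoment (j - 1) s := by
  have c := fun i => (continuous_ovalX_zpow hs i).mul (continuous_density hs)
  have i := intervalIntegrable_moment hs
  have key := integral_eq_zero_of_hasDerivAt
    (G := fun θ => ovalX s θ ^ j * (√(1 / 4 - 2 * s) * Real.sin θ) *
      ((ovalProd s θ + 2 * s) * density s θ))
    (g := fun θ => 4 * s ^ 2 * j * (ovalX s θ ^ (j - 1) * density s θ)
      - (j + 1) * (ovalX s θ ^ (j + 1) * density s θ)
      + (2 * j + 3) * (ovalX s θ ^ (j + 2) * density s θ)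
      - (j + 2) * (ovalX s θ ^ (j + 3) * density s θ))
    (((((c _).const_mul _).sub ((c _).const_mul _)).add ((c _).const_mul _)).sub
      ((c _).const_mul _)) (fun θ => ?_) (by simp) (by simp)
  · rw [intervalIntegral.integral_sub (((i _).const_mul _).sub ((i _).const_mul _) |>.add
        ((i _).const_mul _)) ((i _).const_mul _),
      intervalIntegral.integral_add (((i _).const_mul _).sub ((i _).const_mul _))
        ((i _).const_mul _),
      intervalIntegral.integral_sub ((i _).const_mul _) ((i _).const_mul _)] at key
    simp only [intervalIntegral.integral_const_mul] at key
    unfold ovalMoment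
    linarith
  · have hx := (ovalX_pos hs θ).ne'
    refine ((((hasDerivAt_zpow j _ (Or.inl hx)).comp θ (hasDerivAt_ovalX s θ)).mul
      ((Real.hasDerivAt_sin θ).const_mul _)).mul
      (((hasDerivAt_ovalProd s θ).add_const (2 * s)).mul (hasDerivAt_density hs θ))).congr_deriv ?_
    have h0 := (ovalProd_add_pos hs θ).ne'
    have e1 : ovalX s θ ^ j = ovalX s θ ^ (j - 1) * ovalX s θ := by
      rw [← zpow_add_one₀ hx]; ring_nf
    have e2 : ovalX s θ ^ (j + 1) = ovalX s θ ^ (j - 1) * ovalX s θ ^ 2 := by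
      rw [← zpow_natCast, ← zpow_add₀ hx]; push_cast; ring_nf
    have e3 : ovalX s θ ^ (j + 2) = ovalX s θ ^ (j - 1) * ovalX s θ ^ 3 := by
      rw [← zpow_natCast, ← zpow_add₀ hx]; push_cast; ring_nf
    have e4 : ovalX s θ ^ (j + 3) = ovalX s θ ^ (j - 1) * ovalX s θ ^ 4 := by
      rw [← zpow_natCast, ← zpow_add₀ hx]; push_cast; ring_nf
    have hA := Real.sq_sqrt (show 0 ≤ 1 / 4 - 2 * s by linarith [hs.2])
    have hsin := Real.sin_sq θ
    have hr : √(1 / 4 - 2 * s) * Real.cos θ = ovalX s θ - 1 / 2 := by unfold ovalX; ring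
    have hr' : ovalX s θ * (1 - ovalX s θ) = 1 / 4 - (1 / 4 - 2 * s) * Real.cos θ ^ 2 :=
      ovalX_mul hs θ
    have hy : (ovalProd s θ + 2 * s) * (-((1 / 4 - 2 * s) * (Real.sin θ * Real.cos θ) /
      (ovalProd s θ + 2 * s)) * density s θ) =
        -((1 / 4 - 2 * s) * (Real.sin θ * Real.cos θ)) * density s θ := by
      field_simp
    simp only [Pi.mul_apply, Function.comp_apply]
    rw [hy, e1, e2, e3, e4, ← ovalX_mul hs θ]
    generalize ovalX s θ = x at *
    generalize x ^ (j - 1) = X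
    generalize density s θ = d
    generalize √(1 / 4 - 2 * s) = r at *
    have hq : (1 / 4 - 2 * s) * Real.sin θ ^ 2 = x * (1 - x) - 2 * s := by
      rw [hr', hsin]; ring
    linear_combination (-j * X * (x * (1 - x) + 2 * s) * d) * (Real.sin θ ^ 2 * hA + hq)
      + (X * x * (x * (1 - x) + 2 * s) * d) * hr
      + X * x * d * ((1 / 4 - 2 * s) * Real.sin θ ^ 2 * hr + (x - 1 / 2) * hq)

lemma integral_eq_zero_of_antisymm {f : ℝ → ℝ} (h : ∀ θ, f (Real.pi - θ) = -f θ) :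
    ∫ θ in (0)..Real.pi, f θ = 0 := by
  have h1 := intervalIntegral.integral_comp_sub_left (a := 0) (b := Real.pi) f Real.pi
  simp only [h, intervalIntegral.integral_neg, sub_self, sub_zero] at h1
  linarith

lemma ovalProd_pi_sub (s θ : ℝ) : ovalProd s (Real.pi - θ) = ovalProd s θ := by
  simp [ovalProd]

lemma density_pi_sub (s θ : ℝ) : density s (Real.pi - θ) = density s θ := by
  simp [density, ovalProd_pi_sub]

lemma ovalX_pi_sub (s θ : ℝ) : ovalX s (Real.pi - θ) = 1 - ovalX s θ := by
  simp only [ovalX, Real.cos_pi_sub]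
  ring

lemma ovalMoment_zero (s : ℝ) : ovalMoment 0 s = firstKind s := by
  simp [ovalMoment, firstKind]

lemma ovalMoment_one (hs : s ∈ Ioo (0 : ℝ) (1 / 8)) : ovalMoment 1 s = firstKind s / 2 := by
  have h : ∫ θ in (0)..Real.pi, (ovalX s θ ^ (1 : ℤ) * density s θ - 1 / 2 * density s θ) = 0 :=
    integral_eq_zero_of_antisymm fun θ => by
      rw [ovalX_pi_sub, density_pi_sub, zpow_one, zpow_one]; ring
  rw [intervalIntegral.integral_sub (intervalIntegrable_moment hs 1)
    (((continuous_density hs).intervalIntegrable _ _).const_mul _),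
    intervalIntegral.integral_const_mul] at h
  unfold ovalMoment firstKind
  linarith

lemma ovalMoment_two (hs : s ∈ Ioo (0 : ℝ) (1 / 8)) :
    ovalMoment 2 s = firstKind s / 2 - secondKind s := by
  have i1 : Continuous fun θ => ovalProd s θ * density s θ :=
    (continuous_ovalProd s).mul (continuous_density hs)
  rw [← ovalMoment_one hs]
  unfold ovalMoment secondKind
  rw [← intervalIntegral.integral_sub (intervalIntegrable_moment hs 1)
    (i1.intervalIntegrable _ _)]
  refine intervalIntegral.integral_congr fun θ _ => ?_
  rw [← ovalX_mul hs, zpow_one, show (2 : ℤ) = ((2 : ℕ) : ℤ) from rfl, zpow_natCast]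
  ring

lemma ovalMoment_neg_one (hs : s ∈ Ioo (0 : ℝ) (1 / 8)) :
    s ^ 2 * ovalMoment (-1) s = s * thirdKind s / 2 := by
  have c : Continuous fun θ => s * (ovalProd s θ)⁻¹ * density s θ :=
    (continuous_const.mul (continuous_inv_ovalProd hs)).mul (continuous_density hs)
  have h : ∫ θ in (0)..Real.pi, (s ^ 2 * (ovalX s θ ^ (-1 : ℤ) * density s θ)
      - s / 2 * (s * (ovalProd s θ)⁻¹ * density s θ)) = 0 :=
    integral_eq_zero_of_antisymm fun θ => by
      have hx := (ovalX_pos hs θ).ne'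
      have hx' := (ovalX_pos hs (Real.pi - θ)).ne'
      rw [ovalX_pi_sub] at hx'
      rw [ovalX_pi_sub, ovalProd_pi_sub, density_pi_sub, ← ovalX_mul hs, zpow_neg_one,
        zpow_neg_one]
      field_simp
      ring
  rw [intervalIntegral.integral_sub ((intervalIntegrable_moment hs _).const_mul _)
    ((c.intervalIntegrable _ _).const_mul _),
    intervalIntegral.integral_const_mul, intervalIntegral.integral_const_mul] at h
  unfold ovalMoment thirdKind
  linarith

end Moments

open Polynomial in
/-- Combinations of the three basic integrals with polynomial coefficients in `s ^ 2` whose degrees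
are controlled by the weight `W`. -/
def InModule (W : ℤ) (f : ℝ → ℝ) : Prop :=
  ∃ P A B : ℝ[X], (∀ i, P.coeff i ≠ 0 → 4 * (i : ℤ) + 3 ≤ W) ∧
    (∀ i, A.coeff i ≠ 0 → 4 * (i : ℤ) + 2 ≤ W) ∧ (∀ i, B.coeff i ≠ 0 → 4 * (i : ℤ) ≤ W) ∧
    ∀ s ∈ Ioo (0 : ℝ) (1 / 8), f s = P.eval (s ^ 2) * (s * thirdKind s) +
      A.eval (s ^ 2) * secondKind s + B.eval (s ^ 2) * firstKind s

namespace InModule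

open Polynomial

variable {W W' : ℤ} {f g : ℝ → ℝ}

lemma congr (hf : InModule W f) (h : ∀ s ∈ Ioo (0 : ℝ) (1 / 8), g s = f s) : InModule W g := by
  obtain ⟨P, A, B, hP, hA, hB, he⟩ := hf
  exact ⟨P, A, B, hP, hA, hB, fun s hs => (h s hs).trans (he s hs)⟩

lemma mono (hf : InModule W f) (h : W ≤ W') : InModule W' f := by
  obtain ⟨P, A, B, hP, hA, hB, he⟩ := hf
  exact ⟨P, A, B, fun i hi => (hP i hi).trans h, fun i hi => (hA i hi).trans h,
    fun i hi => (hB i hi).trans h, he⟩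

lemma zero (W : ℤ) : InModule W fun _ => 0 :=
  ⟨0, 0, 0, by simp, by simp, by simp, by simp⟩

lemma add (hf : InModule W f) (hg : InModule W g) : InModule W fun s => f s + g s := by
  obtain ⟨P, A, B, hP, hA, hB, he⟩ := hf
  obtain ⟨P', A', B', hP', hA', hB', he'⟩ := hg
  have key : ∀ {Q R : ℝ[X]} {b : ℤ}, (∀ i, Q.coeff i ≠ 0 → 4 * (i : ℤ) + b ≤ W) →
      (∀ i, R.coeff i ≠ 0 → 4 * (i : ℤ) + b ≤ W) →
      ∀ i, (Q + R).coeff i ≠ 0 → 4 * (i : ℤ) + b ≤ W := by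
    intro Q R b hQ hR i hi
    by_cases h : Q.coeff i = 0
    · exact hR i fun h' => hi (by rw [coeff_add, h, h', add_zero])
    · exact hQ i h
  refine ⟨P + P', A + A', B + B', key hP hP', key hA hA', ?_, fun s hs => ?_⟩
  · simpa using key (b := 0) (by simpa using hB) (by simpa using hB')
  · simp only [he s hs, he' s hs, eval_add]
    ring

lemma const_mul (c : ℝ) (hf : InModule W f) : InModule W fun s => c * f s := by
  obtain ⟨P, A, B, hP, hA, hB, he⟩ := hf
  refine ⟨C c * P, C c * A, C c * B, fun i hi => hP i ?_, fun i hi => hA i ?_,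
    fun i hi => hB i ?_, fun s hs => ?_⟩
  · exact right_ne_zero_of_mul (coeff_C_mul P ▸ hi)
  · exact right_ne_zero_of_mul (coeff_C_mul A ▸ hi)
  · exact right_ne_zero_of_mul (coeff_C_mul B ▸ hi)
  · simp only [he s hs, eval_mul, eval_C]
    ring

lemma sq_mul (hf : InModule W f) : InModule (W + 4) fun s => s ^ 2 * f s := by
  obtain ⟨P, A, B, hP, hA, hB, he⟩ := hf
  have key : ∀ {Q : ℝ[X]} {b : ℤ}, (∀ i, Q.coeff i ≠ 0 → 4 * (i : ℤ) + b ≤ W) →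
      ∀ i : ℕ, (X * Q).coeff i ≠ 0 → 4 * (i : ℤ) + b ≤ W + 4 := by
    intro Q b hQ i hi
    cases i with
    | zero => simp at hi
    | succ i =>
      have := hQ i (by rwa [coeff_X_mul] at hi)
      push_cast
      linarith
  refine ⟨X * P, X * A, X * B, key hP, key hA, ?_, fun s hs => ?_⟩
  · simpa using key (b := 0) (by simpa using hB)
  · simp only [he s hs, eval_mul, eval_X]
    ring

lemma sq_pow_mul (hf : InModule W f) (b : ℕ) : InModule (W + 4 * b) fun s => (s ^ 2) ^ b * f s := by
  induction b with
  | zero => simpa using hf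
  | succ b ih =>
    refine (ih.sq_mul.mono (by push_cast; linarith)).congr fun s _ => ?_
    ring

lemma of_thirdKind : InModule 3 fun s => s * thirdKind s :=
  ⟨1, 0, 0, fun i hi => by have : i = 0 := by simpa [coeff_one] using hi
                           simp [this], by simp, by simp, by simp⟩

lemma of_secondKind : InModule 2 secondKind :=
  ⟨0, 1, 0, by simp, fun i hi => by have : i = 0 := by simpa [coeff_one] using hi
                                    simp [this], by simp, by simp⟩

lemma of_firstKind : InModule 0 firstKind :=
  ⟨0, 0, 1, by simp, by simp, fun i hi => by have : i = 0 := by simpa [coeff_one] using hi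
                                             simp [this], by simp⟩

lemma ovalMoment_natCast (j : ℕ) : InModule j (ovalMoment j) := by
  induction j using Nat.strong_induction_on with
  | _ j ih =>
    match j, ih with
    | 0, _ => exact of_firstKind.congr fun s _ => ovalMoment_zero s
    | 1, _ =>
      refine ((of_firstKind.const_mul (1 / 2)).mono (by norm_num)).congr fun s hs => ?_
      rw [Nat.cast_one, ovalMoment_one hs]
      ring
    | 2, _ =>
      refine (((of_firstKind.const_mul (1 / 2)).mono (by norm_num)).add
        (of_secondKind.const_mul (-1))).congr fun s hs => ?_
      rw [Nat.cast_ofNat, ovalMoment_two hs]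
      ring
    | 3, ih =>
      refine ((((ih 2 (by norm_num)).const_mul (3 / 2)).mono (by norm_num)).add
        (((ih 1 (by norm_num)).const_mul (-1 / 2)).mono (by norm_num))).congr fun s hs => ?_
      have h := ovalMoment_recursion hs 0
      norm_num at h ⊢
      linarith
    | j + 4, ih =>
      have h3 := ih (j + 3) (by omega)
      have h2 := ih (j + 2) (by omega)
      have h0 := ih j (by omega)
      refine ((((h3.const_mul ((2 * j + 5) / (j + 3))).mono (W' := (j + 4 : ℕ)) (by simp)).add
        ((h2.const_mul (-(j + 2) / (j + 3))).mono (by simp))).add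
        ((h0.const_mul (4 * (j + 1) / (j + 3))).sq_mul.mono (by simp))).congr fun s hs => ?_
      have h := ovalMoment_recursion hs (j + 1)
      have hj : (j : ℝ) + 3 ≠ 0 := by positivity
      rw [show (j : ℤ) + 1 + 3 = (j + 4 : ℕ) by push_cast; ring,
        show (j : ℤ) + 1 + 2 = (j + 3 : ℕ) by push_cast; ring,
        show (j : ℤ) + 1 + 1 = (j + 2 : ℕ) by push_cast; ring, add_sub_cancel_right] at h
      push_cast at h
      field_simp
      push_cast
      linarith

lemma ovalMoment_weight_of_neg (n : ℕ) : ∀ b : ℕ, n ≤ 2 * b →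
    InModule (4 * b - n) fun s => (s ^ 2) ^ b * ovalMoment (-n) s := by
  induction n using Nat.strong_induction_on with
  | _ n ih =>
    intro b hb
    have aux : ∀ (c : ℕ) (i : ℤ), -n < i → 0 ≤ 2 * (c : ℤ) + i →
        InModule (4 * c + i) fun s => (s ^ 2) ^ c * ovalMoment i s := by
      intro c i hi hc
      obtain ⟨m, rfl | rfl⟩ := i.eq_nat_or_neg
      · exact ((ovalMoment_natCast m).sq_pow_mul c).mono (by linarith)
      · exact (ih m (by omega) c (by omega)).mono (by linarith)
    match n, hb, aux with
    | 0, _, _ =>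
      exact ((ovalMoment_natCast 0).sq_pow_mul b).mono (by simp)
    | 1, hb, _ =>
      obtain ⟨c, rfl⟩ : ∃ c, b = c + 1 := ⟨b - 1, by omega⟩
      refine (((of_thirdKind.const_mul (1 / 2)).sq_pow_mul c).mono
        (by push_cast; linarith)).congr fun s hs => ?_
      have h := ovalMoment_neg_one hs
      rw [pow_succ, mul_assoc, Nat.cast_one, h]
      ring
    | n + 2, hb, aux =>
      obtain ⟨c, rfl⟩ : ∃ c, b = c + 1 := ⟨b - 1, by omega⟩
      have h3 := aux c (2 - n) (by push_cast; omega) (by push_cast at *; omega)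
      have h2 := aux c (1 - n) (by push_cast; omega) (by push_cast at *; omega)
      have h1 := aux c (-n) (by push_cast; omega) (by push_cast at *; omega)
      refine ((((h3.const_mul ((n - 1) / (4 * (n + 1)))).mono
        (by push_cast; linarith)).add ((h2.const_mul (-(2 * n - 1) / (4 * (n + 1)))).mono
        (by push_cast; linarith))).add ((h1.const_mul (n / (4 * (n + 1)))).mono
        (by push_cast; linarith))).congr fun s hs => ?_
      have h := ovalMoment_recursion hs (-1 - n)
      have hn : (n : ℝ) + 1 ≠ 0 := by positivity
      rw [show -1 - (n : ℤ) + 3 = 2 - n by ring, show -1 - (n : ℤ) + 2 = 1 - n by ring,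
        show -1 - (n : ℤ) + 1 = -n by ring,
        show -1 - (n : ℤ) - 1 = -((n + 2 : ℕ) : ℤ) by push_cast; ring] at h
      push_cast at h ⊢
      field_simp
      linear_combination (s ^ 2) ^ c * h

/-- The weight of a monomial `t ^ b * x ^ j` integrated along the oval. -/
lemma ovalMoment_weight (b : ℕ) (j : ℤ) (h : 0 ≤ 2 * (b : ℤ) + j) :
    InModule (4 * b + j) fun s => (s ^ 2) ^ b * ovalMoment j s := by
  obtain ⟨n, rfl | rfl⟩ := j.eq_nat_or_neg
  · exact ((ovalMoment_natCast n).sq_pow_mul b).mono (by linarith)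
  · exact (ovalMoment_weight_of_neg n b (by omega)).mono (by linarith)

end InModule

/-- Combinations of monomials `t ^ b * x ^ j` with `0 ≤ 2 * b + j` and `4 * b + j ≤ W`. -/
inductive WeightLE (W : ℤ) : (ℝ → ℝ → ℝ) → Prop
  | monomial (c : ℝ) (b : ℕ) (j : ℤ) (h : 0 ≤ 2 * (b : ℤ) + j) (hW : 4 * b + j ≤ W) :
      WeightLE W fun x t => c * (t ^ b * x ^ j)
  | add {φ ψ : ℝ → ℝ → ℝ} (hφ : WeightLE W φ) (hψ : WeightLE W ψ) :
      WeightLE W fun x t => φ x t + ψ x t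
  | congr {φ ψ : ℝ → ℝ → ℝ} (hφ : WeightLE W φ) (h : ∀ x > 0, ∀ t, ψ x t = φ x t) :
      WeightLE W ψ

namespace WeightLE

variable {W W' : ℤ} {φ ψ : ℝ → ℝ → ℝ}

lemma mul (hφ : WeightLE W φ) (hψ : WeightLE W' ψ) :
    WeightLE (W + W') fun x t => φ x t * ψ x t := by
  induction hφ with
  | monomial c b j h hW =>
    induction hψ with
    | monomial c' b' j' h' hW' =>
      refine (monomial (c * c') (b + b') (j + j') (by push_cast; linarith)
        (by push_cast; linarith)).congr fun x hx t => ?_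
      rw [zpow_add₀ hx.ne']
      ring
    | add _ _ h1 h2 => exact (h1.add h2).congr fun x _ t => by ring
    | congr _ hc h1 => exact h1.congr fun x hx t => by rw [hc x hx t]
  | add _ _ h1 h2 => exact (h1.add h2).congr fun x _ t => by ring
  | congr _ hc h1 => exact h1.congr fun x hx t => by rw [hc x hx t]

lemma continuousOn (hφ : WeightLE W φ) (t : ℝ) : ContinuousOn (fun x => φ x t) (Ioi 0) := by
  induction hφ with
  | monomial c b j h hW =>
    exact (((continuousOn_id' _).zpow₀ j fun x hx => Or.inl (ne_of_gt hx)).const_smul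
      (t ^ b)).const_smul c
  | add _ _ h1 h2 => exact h1.add h2
  | congr _ hc h1 => exact h1.congr fun x hx => hc x hx t

lemma continuous_comp (hφ : WeightLE W φ) {s : ℝ} (hs : s ∈ Ioo (0 : ℝ) (1 / 8)) (t : ℝ) :
    Continuous fun θ => φ (ovalX s θ) t :=
  (hφ.continuousOn t).comp_continuous (continuous_ovalX s) fun θ => ovalX_pos hs θ

lemma inModule (hφ : WeightLE W φ) :
    InModule W fun s => ∫ θ in (0)..Real.pi, φ (ovalX s θ) (s ^ 2) * density s θ := by
  induction hφ with
  | monomial c b j h hW =>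
    refine (((InModule.ovalMoment_weight b j h).const_mul c).mono hW).congr fun s _ => ?_
    rw [ovalMoment, ← intervalIntegral.integral_const_mul, ← intervalIntegral.integral_const_mul]
    simp only [mul_assoc]
  | add hφ hψ h1 h2 =>
    refine (h1.add h2).congr fun s hs => ?_
    simp only [add_mul]
    exact intervalIntegral.integral_add
      (((hφ.continuous_comp hs _).mul (continuous_density hs)).intervalIntegrable _ _)
      (((hψ.continuous_comp hs _).mul (continuous_density hs)).intervalIntegrable _ _)
  | congr _ hc h1 =>
    refine h1.congr fun s hs => intervalIntegral.integral_congr fun θ _ => ?_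
    simp only [hc _ (ovalX_pos hs θ)]

lemma zpow (j : ℕ) : WeightLE j fun x _ => x ^ j :=
  (monomial 1 0 j (by simp) (by simp)).congr fun x _ t => by simp

end WeightLE

/-- The quotient `(y₊ ^ j - y₋ ^ j) / (y₊ - y₋)` where `y₊`, `y₋` are the roots of
`y² - (1 - x) y + t / x²`. -/
noncomputable def chordQuotient : ℕ → ℝ → ℝ → ℝ
  | 0, _, _ => 0
  | 1, _, _ => 1
  | j + 2, x, t => (1 - x) * chordQuotient (j + 1) x t - t / x ^ 2 * chordQuotient j x t

lemma pow_sub_pow_eq_chordQuotient {x t c h : ℝ} (hc : 2 * c = 1 - x)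
    (hh : c ^ 2 - h ^ 2 = t / x ^ 2) (j : ℕ) :
    (c + h) ^ j - (c - h) ^ j = 2 * h * chordQuotient j x t := by
  induction j using Nat.twoStepInduction with
  | zero => simp [chordQuotient]
  | one => simp [chordQuotient]; ring
  | more j h0 h1 =>
    rw [chordQuotient, ← hc, ← hh]
    linear_combination 2 * c * h1 - (c ^ 2 - h ^ 2) * h0

lemma weightLE_chordQuotient (j : ℕ) : WeightLE j (chordQuotient (j + 1)) := by
  have h1 : WeightLE 1 fun x _ => 1 - x :=
    ((WeightLE.monomial 1 0 0 (by simp) (by simp)).add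
      (WeightLE.monomial (-1) 0 1 (by simp) (by simp))).congr fun x _ t => by
        simp [sub_eq_add_neg]
  have h2 : WeightLE 2 fun x t => -(t / x ^ 2) :=
    (WeightLE.monomial (-1) 1 (-2) (by simp) (by simp)).congr fun x _ t => by
      simp [zpow_neg, div_eq_mul_inv]
  have h0 : WeightLE 0 (chordQuotient 1) :=
    (WeightLE.monomial 1 0 0 (by simp) (by simp)).congr fun x _ t => by
      simp [chordQuotient]
  induction j using Nat.twoStepInduction with
  | zero => exact h0
  | one => exact h1.congr fun x _ t => by simp [chordQuotient]
  | more j i0 i1 =>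
    have e1 := h1.mul i1
    have e2 := h2.mul i0
    rw [show (1 : ℤ) + (j + 1 : ℕ) = (j + 2 : ℕ) by push_cast; ring] at e1
    rw [show (2 : ℤ) + j = (j + 2 : ℕ) by push_cast; ring] at e2
    exact (e1.add e2).congr fun x _ t => by rw [chordQuotient]; ring

lemma weightLE_discriminant : WeightLE 3 fun x t => x * (1 - x) ^ 2 - 4 * t / x :=
  ((((WeightLE.monomial 1 0 1 (by simp) (by simp)).add
    (WeightLE.monomial (-2) 0 2 (by simp) (by simp))).add
    (WeightLE.monomial 1 0 3 (by simp) (by simp))).add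
    (WeightLE.monomial (-4) 1 (-1) (by simp) (by simp))).congr fun x _ t => by
      rw [show (2 : ℤ) = (2 : ℕ) from rfl, show (3 : ℤ) = (3 : ℕ) from rfl, zpow_natCast,
        zpow_natCast]
      simp
      ring

section Region

/-- Half of the length of the vertical chord of the oval `{H = t}` at the abscissa `x`. -/
noncomputable def halfChord (t x : ℝ) : ℝ := √((1 - x) ^ 2 / 4 - t / x ^ 2)

variable {s : ℝ}

lemma mem_Icc_ovalX_iff (hs : s ∈ Ioo (0 : ℝ) (1 / 8)) (x : ℝ) :
    x ∈ Icc (ovalX s Real.pi) (ovalX s 0) ↔ 2 * s ≤ x * (1 - x) := by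
  have h : x * (1 - x) = 1 / 4 - (x - 1 / 2) ^ 2 := by ring
  have h1 : 2 * s ≤ x * (1 - x) ↔ |x - 1 / 2| ≤ √(1 / 4 - 2 * s) := by
    rw [← Real.sqrt_sq_eq_abs, Real.sqrt_le_sqrt_iff (by linarith [hs.2]), h]
    constructor <;> intro <;> linarith
  rw [h1, abs_le, mem_Icc, ovalX, ovalX, Real.cos_pi, Real.cos_zero]
  constructor <;> rintro ⟨_, _⟩ <;> constructor <;> linarith

lemma mem_Δset_iff (hs : s ∈ Ioo (0 : ℝ) (1 / 8)) (x y : ℝ) :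
    (x, y) ∈ Δset (s ^ 2) ↔ x ∈ Icc (ovalX s Real.pi) (ovalX s 0) ∧
      y ∈ Icc ((1 - x) / 2 - halfChord (s ^ 2) x) ((1 - x) / 2 + halfChord (s ^ 2) x) := by
  have hs0 := hs.1
  have hst : 0 < s ^ 2 := by positivity
  have hchord : y ∈ Icc ((1 - x) / 2 - halfChord (s ^ 2) x) ((1 - x) / 2 + halfChord (s ^ 2) x) ↔
      |y - (1 - x) / 2| ≤ halfChord (s ^ 2) x := by
    rw [abs_le, mem_Icc]
    constructor <;> rintro ⟨_, _⟩ <;> constructor <;> linarith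
  rw [mem_Icc_ovalX_iff hs, hchord]
  simp only [Δset, mem_ofPred_eq]
  constructor
  · rintro ⟨hx, hy, h⟩
    have hx2 : 0 < x ^ 2 := by positivity
    have h1 : s ^ 2 / x ^ 2 ≤ y * (1 - x - y) := by
      rw [div_le_iff₀ hx2]; linarith
    have h2 : 0 < 1 - x - y := by
      by_contra! h2
      nlinarith [mul_nonneg (mul_nonneg hx2.le hy.le) (neg_nonneg.2 h2)]
    refine ⟨?_, Real.abs_le_sqrt (by linarith)⟩
    refine (abs_le_of_sq_le_sq' (a := 2 * s) (b := x * (1 - x)) ?_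
      (mul_nonneg hx.le (by linarith))).2
    nlinarith [mul_nonneg hx2.le (sq_nonneg (y - (1 - x) / 2))]
  · rintro ⟨hx, hy⟩
    have hx0 : 0 < x := by
      by_contra! h
      nlinarith
    have hx1 : 0 < 1 - x := by
      by_contra! h
      nlinarith
    have hx2 : 0 < x ^ 2 := by positivity
    have hD : 0 ≤ (1 - x) ^ 2 / 4 - s ^ 2 / x ^ 2 := by
      rw [sub_nonneg, div_le_div_iff₀ hx2 (by norm_num)]
      nlinarith
    have h1 : (y - (1 - x) / 2) ^ 2 ≤ (1 - x) ^ 2 / 4 - s ^ 2 / x ^ 2 := by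
      rw [← Real.sq_sqrt hD]
      exact sq_le_sq.2 (hy.trans (le_abs_self _))
    have h2 : s ^ 2 / x ^ 2 ≤ y * (1 - x - y) := by linarith
    have h3 : 0 < y * (1 - x - y) := lt_of_lt_of_le (by positivity) h2
    refine ⟨hx0, ?_, ?_⟩
    · by_contra! h
      nlinarith
    · rw [div_le_iff₀ hx2] at h2
      linarith

lemma measurableSet_Δset (t : ℝ) : MeasurableSet (Δset t) :=
  have h : Measurable fun z : ℝ × ℝ => z.1 ^ 2 * z.2 * (1 - z.1 - z.2) := by fun_prop
  (measurableSet_lt measurable_const measurable_fst).inter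
    ((measurableSet_lt measurable_const measurable_snd).inter
      (measurableSet_le measurable_const h))

lemma Δset_subset {t : ℝ} (ht : 0 < t) : Δset t ⊆ Icc 0 1 ×ˢ Icc 0 1 := by
  rintro ⟨x, y⟩ ⟨hx, hy, h⟩
  simp only at hx hy h
  have h2 : 0 < 1 - x - y := by
    by_contra! h2
    nlinarith [mul_nonneg (mul_nonneg (sq_nonneg x) hy.le) (neg_nonneg.2 h2)]
  exact ⟨⟨hx.le, by simp only; linarith⟩, ⟨hy.le, by simp only; linarith⟩⟩

lemma integrableOn_Δset {t : ℝ} (ht : 0 < t) {f : ℝ × ℝ → ℝ} (hf : Continuous f) :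
    IntegrableOn f (Δset t) :=
  (hf.continuousOn.integrableOn_compact (isCompact_Icc.prod isCompact_Icc)).mono_set
    (Δset_subset ht)

/-- Integration over the region bounded by the oval by vertical slices. -/
lemma integral_Δset (hs : s ∈ Ioo (0 : ℝ) (1 / 8)) {f : ℝ × ℝ → ℝ} (hf : Continuous f) :
    ∫ z in Δset (s ^ 2), f z = ∫ x in (ovalX s Real.pi)..(ovalX s 0),
      ∫ y in ((1 - x) / 2 - halfChord (s ^ 2) x)..((1 - x) / 2 + halfChord (s ^ 2) x),
        f (x, y) := by
  have hm := measurableSet_Δset (s ^ 2)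
  have hi := (integrable_indicator_iff hm).2 (integrableOn_Δset (pow_pos hs.1 2) hf)
  have hle : ovalX s Real.pi ≤ ovalX s 0 := by
    simp only [ovalX, Real.cos_pi, Real.cos_zero]
    linarith [Real.sqrt_nonneg (1 / 4 - 2 * s)]
  rw [← integral_indicator hm, Measure.volume_eq_prod, integral_prod _ hi,
    intervalIntegral.integral_of_le hle, ← integral_Icc_eq_integral_Ioc,
    ← integral_indicator measurableSet_Icc]
  congr 1 with x
  by_cases hx : x ∈ Icc (ovalX s Real.pi) (ovalX s 0)
  · have hh := Real.sqrt_nonneg ((1 - x) ^ 2 / 4 - s ^ 2 / x ^ 2)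
    rw [indicator_of_mem hx, intervalIntegral.integral_of_le (by unfold halfChord; linarith),
      ← integral_Icc_eq_integral_Ioc, ← integral_indicator measurableSet_Icc]
    congr 1 with y
    simp only [indicator, mem_Δset_iff hs, hx, true_and]
  · rw [indicator_of_notMem hx]
    simp [indicator, mem_Δset_iff hs, hx]

lemma two_mul_halfChord_mul_sin (hs : s ∈ Ioo (0 : ℝ) (1 / 8)) {θ : ℝ}
    (hθ : θ ∈ Icc 0 Real.pi) :
    2 * halfChord (s ^ 2) (ovalX s θ) * (√(1 / 4 - 2 * s) * Real.sin θ) =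
      (ovalX s θ * (1 - ovalX s θ) ^ 2 - 4 * s ^ 2 / ovalX s θ) * density s θ := by
  have hx := ovalX_pos hs θ
  have hz := ovalX_mul hs θ
  have hy := ovalProd_add_pos hs θ
  have hr := Real.sq_sqrt (show 0 ≤ 1 / 4 - 2 * s by linarith [hs.2])
  have hy2 := Real.sq_sqrt hy.le
  have hy0 := (Real.sqrt_pos.2 hy).ne'
  have hsin : (1 / 4 - 2 * s) * Real.sin θ ^ 2 = ovalProd s θ - 2 * s := by
    rw [Real.sin_sq, ovalProd]; ring
  have hh : halfChord (s ^ 2) (ovalX s θ) =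
      √(1 / 4 - 2 * s) * Real.sin θ * √(ovalProd s θ + 2 * s) / (2 * ovalX s θ) := by
    have hsin0 := Real.sin_nonneg_of_mem_Icc hθ
    rw [halfChord, ← Real.sqrt_sq (show 0 ≤ √(1 / 4 - 2 * s) * Real.sin θ *
      √(ovalProd s θ + 2 * s) / (2 * ovalX s θ) by positivity)]
    congr 1
    rw [div_pow, mul_pow, mul_pow, hr, hy2, hsin, ← hz]
    field_simp
    ring
  rw [hh, density]
  generalize √(1 / 4 - 2 * s) = r at *
  field_simp
  rw [hr, hy2, hsin, ← hz]
  ring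

/-- A monomial integrated over the region bounded by the oval, in the angular parameter. -/
lemma integral_Δset_monomial (hs : s ∈ Ioo (0 : ℝ) (1 / 8)) (i j : ℕ) :
    ∫ z in Δset (s ^ 2), z.1 ^ i * z.2 ^ j = 1 / (j + 1) * ∫ θ in (0)..Real.pi,
      ovalX s θ ^ i * chordQuotient (j + 1) (ovalX s θ) (s ^ 2) *
        (ovalX s θ * (1 - ovalX s θ) ^ 2 - 4 * s ^ 2 / ovalX s θ) * density s θ := by
  have hpos : ∀ x ∈ Icc (ovalX s Real.pi) (ovalX s 0), 0 < x := fun x hx =>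
    (ovalX_pos hs _).trans_le hx.1
  set g : ℝ → ℝ := fun x =>
    x ^ i * chordQuotient (j + 1) x (s ^ 2) * (2 * halfChord (s ^ 2) x) with hg
  have hslice : ∀ x ∈ Icc (ovalX s Real.pi) (ovalX s 0),
      ∫ y in ((1 - x) / 2 - halfChord (s ^ 2) x)..((1 - x) / 2 + halfChord (s ^ 2) x),
        x ^ i * y ^ j = 1 / (j + 1) * g x := by
    intro x hx
    have hx0 := hpos x hx
    have hzx := (mem_Icc_ovalX_iff hs x).1 hx
    have hD : 0 ≤ (1 - x) ^ 2 / 4 - s ^ 2 / x ^ 2 := by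
      rw [sub_nonneg, div_le_div_iff₀ (by positivity) (by norm_num)]
      nlinarith [hs.1]
    have h := pow_sub_pow_eq_chordQuotient (x := x) (t := s ^ 2) (c := (1 - x) / 2)
      (h := halfChord (s ^ 2) x) (by ring) (by rw [halfChord, Real.sq_sqrt hD]; ring) (j + 1)
    rw [intervalIntegral.integral_const_mul, integral_pow, h, hg]
    ring
  have hle : ovalX s Real.pi ≤ ovalX s 0 := by
    simp only [ovalX, Real.cos_pi, Real.cos_zero]
    linarith [Real.sqrt_nonneg (1 / 4 - 2 * s)]
  have hgc : ContinuousOn g (ovalX s '' uIcc 0 Real.pi) := by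
    have h0 : ovalX s '' uIcc 0 Real.pi ⊆ Ioi 0 := by
      rintro _ ⟨θ, _, rfl⟩
      exact ovalX_pos hs θ
    refine ContinuousOn.mono ?_ h0
    refine ((continuousOn_pow i).mul ((weightLE_chordQuotient j).continuousOn _)).mul
      (continuousOn_const.mul (ContinuousOn.sqrt (ContinuousOn.sub (by fun_prop)
        (continuousOn_const.div (by fun_prop) fun x hx => pow_ne_zero 2 (ne_of_gt hx)))))
  have hsub := intervalIntegral.integral_comp_mul_deriv'' (a := 0) (b := Real.pi) (f := ovalX s)
    (f' := fun θ => -(√(1 / 4 - 2 * s) * Real.sin θ)) (g := g)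
    (continuous_ovalX s).continuousOn (fun θ _ => (hasDerivAt_ovalX s θ).hasDerivWithinAt)
    (by fun_prop) hgc
  rw [integral_Δset hs (f := fun z => z.1 ^ i * z.2 ^ j) (by fun_prop),
    intervalIntegral.integral_congr (g := fun x => 1 / (j + 1) * g x)
      (fun x hx => hslice x (uIcc_of_le hle ▸ hx)),
    intervalIntegral.integral_const_mul, intervalIntegral.integral_symm, ← hsub,
    ← intervalIntegral.integral_neg]
  congr 1
  refine intervalIntegral.integral_congr fun θ hθ => ?_
  rw [uIcc_of_le Real.pi_pos.le] at hθ
  have h := two_mul_halfChord_mul_sin hs hθ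
  simp only [hg, Function.comp_apply]
  linear_combination ovalX s θ ^ i * chordQuotient (j + 1) (ovalX s θ) (s ^ 2) * h

end Region

lemma inModule_integral_monomial (i j : ℕ) :
    InModule (i + j + 3) fun s => ∫ z in Δset (s ^ 2), z.1 ^ i * z.2 ^ j :=
  ((((WeightLE.zpow i).mul (weightLE_chordQuotient j)).mul
    weightLE_discriminant).inModule.const_mul (1 / (j + 1))).congr fun _ hs =>
      integral_Δset_monomial hs i j

open MvPolynomial in
lemma inModule_integral_eval {n : ℕ} {R : MvPolynomial (Fin 2) ℝ} (hR : R.totalDegree ≤ n) :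
    InModule (n + 3) fun s => ∫ z in Δset (s ^ 2), eval ![z.1, z.2] R := by
  have hsum : ∀ F : Finset (Fin 2 →₀ ℕ), F ⊆ R.support →
      InModule (n + 3) fun s => ∑ d ∈ F,
        R.coeff d * ∫ z in Δset (s ^ 2), z.1 ^ d 0 * z.2 ^ d 1 := by
    intro F
    induction F using Finset.induction_on with
    | empty => exact fun _ => by simpa using InModule.zero _
    | insert d F hd ih =>
      intro hF
      have hdeg : d 0 + d 1 ≤ n := by
        have := (le_totalDegree (hF (Finset.mem_insert_self d F))).trans hR
        rwa [Finsupp.sum_fintype _ _ (by simp), Fin.sum_univ_two] at this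
      simp only [Finset.sum_insert hd]
      exact (((inModule_integral_monomial (d 0) (d 1)).const_mul _).mono
        (by omega)).add (ih ((Finset.subset_insert d F).trans hF))
  refine (hsum _ subset_rfl).congr fun s hs => ?_
  simp only [eval_eq', Fin.prod_univ_two, Matrix.cons_val_zero, Matrix.cons_val_one]
  rw [integral_finsetSum _ fun d _ => integrableOn_Δset (pow_pos hs.1 2) (by fun_prop)]
  simp only [integral_const_mul]

open MvPolynomial in
lemma totalDegree_pderiv_le {n : ℕ} {R : MvPolynomial (Fin 2) ℝ} (hR : R.totalDegree ≤ n + 1)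
    (i : Fin 2) : (pderiv i R).totalDegree ≤ n := by
  rw [R.as_sum, map_sum]
  refine totalDegree_finsetSum_le fun d hd => ?_
  rw [pderiv_monomial]
  by_cases hdi : d i = 0
  · simp [hdi]
  refine (totalDegree_monomial_le _ _).trans ?_
  have h := (le_totalDegree hd).trans hR
  rw [Finsupp.sum_fintype _ _ (by simp), Fin.sum_univ_two] at h ⊢
  fin_cases i <;> simp at hdi ⊢ <;> omega

lemma zerosLE_of_inModule {n : ℕ} {f : ℝ → ℝ} (hf : InModule (n + 3) fun s => f (s ^ 2)) :
    ZerosLE f (7 * (n / 4 + 1) + 2) := by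
  obtain ⟨P, A, B, hP, hA, hB, he⟩ := hf
  refine (picardFuchs_integrals.zerosLE_with_third_kind (n / 4 + 1) 0 P A B ?_ ?_ ?_).congr
    fun t ht => ?_
  · refine (Polynomial.degree_lt_iff_coeff_zero _ _).2 fun i hi => ?_
    by_contra h
    have := hP i h
    omega
  · refine Polynomial.natDegree_le_iff_coeff_eq_zero.2 fun i hi => ?_
    by_contra h
    have := hA i h
    omega
  · refine Polynomial.natDegree_le_iff_coeff_eq_zero.2 fun i hi => ?_
    by_contra h
    have := hB i h
    omega
  · have h := he _ (sqrt_mem_Ioo ht)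
    have h0 := (sqrt_mem_Ioo ht).1.ne'
    simp only [Real.sq_sqrt ht.1.le] at h
    rw [h, pow_zero, mul_one, ← mul_eq_zero_iff_left h0]
    field_simp
    rw [add_assoc]

open MvPolynomial in
lemma zerosLE_abelIntX {n : ℕ} {p q : MvPolynomial (Fin 2) ℝ} (hp : p.totalDegree ≤ n)
    (hq : q.totalDegree ≤ n) : ZerosLE (abelIntX p q) (7 * (n / 4 + 1) + 2) := by
  have key : ∀ r : MvPolynomial (Fin 2) ℝ, r.totalDegree ≤ n → ∀ i,
      (pderiv i (X 0 * r)).totalDegree ≤ n := fun r hr i =>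
    totalDegree_pderiv_le ((totalDegree_mul _ _).trans (by rw [totalDegree_X]; omega)) i
  exact zerosLE_of_inModule (inModule_integral_eval
    ((totalDegree_sub _ _).trans (max_le (key q hq 0) (key p hp 1))))

/-- Isolated zeros are among the zeros, and a vanishing function has none. -/
lemma ZerosLE.isolated_zeros {f : ℝ → ℝ} {N : ℕ} (hf : ZerosLE f N) :
    {t | t ∈ Ioo (0 : ℝ) (1 / 64) ∧ f t = 0 ∧
      ∀ᶠ s in nhdsWithin t (Ioo (0 : ℝ) (1 / 64) \ {t}), f s ≠ 0}.Finite ∧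
    {t | t ∈ Ioo (0 : ℝ) (1 / 64) ∧ f t = 0 ∧
      ∀ᶠ s in nhdsWithin t (Ioo (0 : ℝ) (1 / 64) \ {t}), f s ≠ 0}.ncard ≤ N := by
  rcases hf with hf | ⟨hfin, hcard⟩
  · have hempty : {t | t ∈ Ioo (0 : ℝ) (1 / 64) ∧ f t = 0 ∧
        ∀ᶠ s in nhdsWithin t (Ioo (0 : ℝ) (1 / 64) \ {t}), f s ≠ 0} = ∅ := by
      refine eq_empty_of_forall_notMem fun t ⟨ht, _, h⟩ => ?_
      rw [sdiff_eq, nhdsWithin_inter_of_mem (mem_nhdsWithin_of_mem_nhds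
        (isOpen_Ioo.mem_nhds ht))] at h
      have h2 : ∀ᶠ s in nhdsWithin t {t}ᶜ, s ∈ Ioo (0 : ℝ) (1 / 64) :=
        mem_nhdsWithin_of_mem_nhds (isOpen_Ioo.mem_nhds ht)
      obtain ⟨s, h3, h4⟩ := (h.and h2).exists
      exact h3 (hf s h4)
    rw [hempty]
    simp
  · have hsub : {t | t ∈ Ioo (0 : ℝ) (1 / 64) ∧ f t = 0 ∧
        ∀ᶠ s in nhdsWithin t (Ioo (0 : ℝ) (1 / 64) \ {t}), f s ≠ 0} ⊆
        {t | t ∈ Ioo (0 : ℝ) (1 / 64) ∧ f t = 0} := fun t ht => ⟨ht.1, ht.2.1⟩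
    exact ⟨hfin.subset hsub, (ncard_le_ncard hsub hfin).trans hcard⟩

/-- the number of isolated zeros of `Ĩ(t) = ∮_{δ(t)} x (p dx + q dy)` on
`(0, 1/64)` is finite and at most `(7 n + 43)/4`. -/
theorem number_of_zeros_abelian_integral_cycles (n : ℕ) (p q : MvPolynomial (Fin 2) ℝ)
    (hp : p.totalDegree ≤ n) (hq : q.totalDegree ≤ n) :
    (({t | t ∈ Set.Ioo (0 : ℝ) (1 / 64) ∧ abelIntX p q t = 0 ∧
        ∀ᶠ s in nhdsWithin t (Set.Ioo (0 : ℝ) (1 / 64) \ {t}), abelIntX p q s ≠ 0} :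
          Set ℝ)).Finite ∧
    4 * ({t | t ∈ Set.Ioo (0 : ℝ) (1 / 64) ∧ abelIntX p q t = 0 ∧
        ∀ᶠ s in nhdsWithin t (Set.Ioo (0 : ℝ) (1 / 64) \ {t}), abelIntX p q s ≠ 0} :
          Set ℝ).ncard ≤ 7 * n + 43 := by
  obtain ⟨h1, h2⟩ := (zerosLE_abelIntX hp hq).isolated_zeros
  exact ⟨h1, by omega⟩
end

section
/- For all integers k, l ∈ ℤ and all t ∈ (0, 1/64), the Abelian integrals I_{i,j} satisfy the relation t·(l+1)·I_{k,l}(t) = (l+2)·I_{k+2,l+1}(t) − (l+2)·I_{k+3,l+1}(t) − (l+3)·I_{k+2,l+2}(t). -/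
open MeasureTheory Set Filter

theorem isCompact_Δset {t : ℝ} (ht : 0 < t) : IsCompact (Δset t) := by
  have h : Δset t = (Icc (0 : ℝ) 1 ×ˢ Icc (0 : ℝ) 1) ∩
      {z : ℝ × ℝ | t ≤ z.1 ^ 2 * z.2 * (1 - z.1 - z.2)} := by
    ext ⟨x, y⟩
    simp only [Δset, mem_ofPred_eq, mem_inter_iff, mem_prod, mem_Icc]
    constructor
    · rintro ⟨hx, hy, h⟩
      have h1 : 0 < 1 - x - y := pos_of_mul_pos_right (ht.trans_le h) (by positivity)
      refine ⟨⟨⟨hx.le, ?_⟩, hy.le, ?_⟩, h⟩ <;> linarith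
    · rintro ⟨⟨⟨hx, -⟩, hy, -⟩, h⟩
      refine ⟨hx.lt_of_ne' ?_, hy.lt_of_ne' ?_, h⟩ <;> rintro rfl <;> simp at h <;> linarith
  rw [h]
  exact (isCompact_Icc.prod isCompact_Icc).inter_right
    (isClosed_le continuous_const (by fun_prop))

theorem integrableOn_zpow_mul_zpow_Δset (i j : ℤ) {t : ℝ} (ht : 0 < t) :
    IntegrableOn (fun z : ℝ × ℝ => z.1 ^ i * z.2 ^ j) (Δset t) := by
  refine ContinuousOn.integrableOn_compact (isCompact_Δset ht) ?_
  exact (continuousOn_fst.zpow₀ i fun z hz => Or.inl hz.1.ne').mul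
    (continuousOn_snd.zpow₀ j fun z hz => Or.inl hz.2.1.ne')

/-- A vertical slice of `Δset t` is empty or a compact interval in `(0, ∞)` with end points on the
level curve. -/
theorem slice_Δset_eq {t : ℝ} (ht : 0 < t) (x : ℝ) :
    {y | (x, y) ∈ Δset t} = ∅ ∨ ∃ a b, 0 < x ∧ 0 < a ∧ a ≤ b ∧ {y | (x, y) ∈ Δset t} = Icc a b ∧
      x ^ 2 * a * (1 - x - a) = t ∧ x ^ 2 * b * (1 - x - b) = t := by
  rcases eq_empty_or_nonempty {y | (x, y) ∈ Δset t} with h | ⟨y₀, hx, hy₀, h₀⟩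
  · exact Or.inl h
  right
  dsimp only at hx hy₀ h₀
  have h1 : 0 < 1 - x - y₀ := pos_of_mul_pos_right (ht.trans_le h₀) (by positivity)
  have key : ∀ y, x ^ 2 * y * (1 - x - y) - t =
      x ^ 2 * (((1 - x) / 2) ^ 2 - t / x ^ 2 - (y - (1 - x) / 2) ^ 2) := fun y => by
    field_simp
    ring
  have hx2 : 0 < x ^ 2 := by positivity
  set E := ((1 - x) / 2) ^ 2 - t / x ^ 2 with hE
  have hE0 : 0 ≤ E := by
    have := nonneg_of_mul_nonneg_right ((key y₀).symm.trans_ge (sub_nonneg.2 h₀)) hx2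
    nlinarith [sq_nonneg (y₀ - (1 - x) / 2)]
  have hr : √E ^ 2 = E := Real.sq_sqrt hE0
  have hpos : √E < (1 - x) / 2 := by
    rw [Real.sqrt_lt' (by linarith)]
    have : 0 < t / x ^ 2 := by positivity
    linarith
  refine ⟨(1 - x) / 2 - √E, (1 - x) / 2 + √E, hx, by linarith,
    by linarith [Real.sqrt_nonneg E], ?_, ?_, ?_⟩
  · ext y
    have hiff : t ≤ x ^ 2 * y * (1 - x - y) ↔ (y - (1 - x) / 2) ^ 2 ≤ E := by
      rw [← sub_nonneg, key, mul_nonneg_iff_of_pos_left hx2, sub_nonneg]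
    simp only [Δset, mem_ofPred_eq, mem_Icc, hiff, Real.sq_le hE0]
    constructor
    · rintro ⟨-, -, h2, h3⟩
      constructor <;> linarith
    · rintro ⟨h2, h3⟩
      refine ⟨hx, ?_, ?_, ?_⟩ <;> linarith
  · rw [← sub_eq_zero, key]
    linear_combination -x ^ 2 * hr
  · rw [← sub_eq_zero, key]
    linear_combination -x ^ 2 * hr

theorem hasDerivAt_zpow_mul_level (x t : ℝ) (l : ℤ) {y : ℝ} (hy : y ≠ 0) :
    HasDerivAt (fun y : ℝ => y ^ (l + 1) * (x ^ 2 * y * (1 - x - y) - t))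
      ((l + 2) * (x ^ 2 * (1 - x)) * y ^ (l + 1) - (l + 3) * x ^ 2 * y ^ (l + 2) -
        t * (l + 1) * y ^ l) y := by
  have h := (hasDerivAt_zpow (l + 1) y (Or.inl hy)).mul
    ((((hasDerivAt_id y).const_mul (x ^ 2)).mul
      ((hasDerivAt_id y).const_sub (1 - x))).sub_const t)
  refine h.congr_deriv ?_
  simp only [id, zpow_add₀ hy, add_sub_cancel_right, zpow_one, Pi.mul_apply]
  rw [show (2 : ℤ) = 1 + 1 from rfl, zpow_add₀ hy, zpow_one]
  push_cast
  ring

theorem setIntegral_slice_Δset_eq_zero (l : ℤ) {t : ℝ} (ht : 0 < t) (x : ℝ) :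
    ∫ y in {y | (x, y) ∈ Δset t}, ((l + 2) * (x ^ 2 * (1 - x)) * y ^ (l + 1) -
      (l + 3) * x ^ 2 * y ^ (l + 2) - t * (l + 1) * y ^ l) = 0 := by
  rcases slice_Δset_eq ht x with h | ⟨a, b, -, ha, hab, h, hta, htb⟩
  · simp [h]
  have hne : ∀ y ∈ uIcc a b, y ≠ 0 := fun y hy => by
    rw [uIcc_of_le hab] at hy
    exact (ha.trans_le hy.1).ne'
  have hc : ∀ j : ℤ, ContinuousOn (fun y : ℝ => y ^ j) (uIcc a b) := fun j =>
    continuousOn_id.zpow₀ j fun y hy => Or.inl (hne y hy)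
  rw [h, integral_Icc_eq_integral_Ioc, ← intervalIntegral.integral_of_le hab,
    intervalIntegral.integral_eq_sub_of_hasDerivAt
      (fun y hy => hasDerivAt_zpow_mul_level x t l (hne y hy))]
  · simp [hta, htb]
  · exact ((((hc _).const_mul _).sub ((hc _).const_mul _)).sub
      ((hc _).const_mul _)).intervalIntegrable

/-- second relation of Lemma 2.2 specialized to `H = x²y - x³y - x²y²`. -/
theorem abelian_integral_relation_two (k l : ℤ) (t : ℝ) (ht : t ∈ Set.Ioo (0 : ℝ) (1 / 64)) :
    t * ((l : ℝ) + 1) * Iab k l t =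
      ((l : ℝ) + 2) * Iab (k + 2) (l + 1) t - ((l : ℝ) + 2) * Iab (k + 3) (l + 1) t -
        ((l : ℝ) + 3) * Iab (k + 2) (l + 2) t := by
  have ht0 := ht.1
  have hm : MeasurableSet (Δset t) := (isCompact_Δset ht0).measurableSet
  have hI := fun (c : ℝ) (i j : ℤ) => (integrableOn_zpow_mul_zpow_Δset i j ht0).const_mul c
  have hF := (((hI (l + 2) (k + 2) (l + 1)).sub (hI (l + 2) (k + 3) (l + 1))).sub
    (hI (l + 3) (k + 2) (l + 2))).sub (hI (t * (l + 1)) k l)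
  have hzero := integral_prod _ ((integrable_indicator_iff hm).2 hF)
  rw [← Measure.volume_eq_prod, integral_indicator hm, integral_sub'
    (((hI _ _ _).sub (hI _ _ _)).sub (hI _ _ _)) (hI _ _ _), integral_sub'
    ((hI _ _ _).sub (hI _ _ _)) (hI _ _ _), integral_sub' (hI _ _ _) (hI _ _ _)] at hzero
  simp only [integral_const_mul] at hzero
  suffices hs : ∀ x : ℝ, ∫ y, (Δset t).indicator (((((fun z : ℝ × ℝ =>
      ((l : ℝ) + 2) * (z.1 ^ (k + 2) * z.2 ^ (l + 1))) - fun z =>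
      ((l : ℝ) + 2) * (z.1 ^ (k + 3) * z.2 ^ (l + 1))) - fun z =>
      ((l : ℝ) + 3) * (z.1 ^ (k + 2) * z.2 ^ (l + 2))) - fun z =>
      t * ((l : ℝ) + 1) * (z.1 ^ k * z.2 ^ l))) (x, y) = 0 by
    rw [integral_congr_ae (.of_forall hs), integral_zero] at hzero
    unfold Iab
    linarith
  intro x
  rw [← mul_zero (x ^ k), ← setIntegral_slice_Δset_eq_zero l ht0 x, ← integral_const_mul,
    ← integral_indicator (show MeasurableSet {y | (x, y) ∈ Δset t} from
      measurable_prodMk_left hm)]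
  congr 1 with y
  by_cases hy : (x, y) ∈ Δset t
  · have hx : x ≠ 0 := hy.1.ne'
    rw [indicator_of_mem hy, indicator_of_mem (show y ∈ {y | (x, y) ∈ Δset t} from hy)]
    simp only [Pi.sub_apply, zpow_add₀ hx]
    norm_cast
    ring
  · rw [indicator_of_notMem hy, indicator_of_notMem (show y ∉ {y | (x, y) ∈ Δset t} from hy)]
end
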